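/- An absolute Borel space (a metrizable space homeomorphic to a Borel subspace of a completely metrizable space) is 2^ω-partitionable if and only if it is 2^ω-coverable. -/

import Mathlib

open Cardinal Set TopologicalSpace

/-- The Cantor space `2^ω`. -/
abbrev CantorSpace : Type := ℕ → Bool

/-- `X` is `Y`-coverable: there is a family of subspaces of `X`, each homeomorphic to `Y`,
whose union is `X`. -/
def Coverable (X Y : Type*) [TopologicalSpace X] [TopologicalSpace Y] : Prop :=
  ∃ C : Set (Set X), (∀ K ∈ C, Nonempty (K ≃ₜ Y)) ∧ ⋃₀ C = Set.univ

/-- `X` is `Y`-partitionable: there is a partition of `X` into pairwise disjoint subspaces,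
each homeomorphic to `Y`. -/
def Partitionable (X Y : Type*) [TopologicalSpace X] [TopologicalSpace Y] : Prop :=
  ∃ P : Set (Set X), (∀ K ∈ P, Nonempty (K ≃ₜ Y)) ∧ P.PairwiseDisjoint id ∧ ⋃₀ P = Set.univ

/-- A packing of copies of `Y` into `X`: a pairwise disjoint family of subspaces of `X`,
each homeomorphic to `Y`. -/
def IsPacking {X : Type*} [TopologicalSpace X] (Y : Type*) [TopologicalSpace Y]
    (Q : Set (Set X)) : Prop :=
  (∀ K ∈ Q, Nonempty (K ≃ₜ Y)) ∧ Q.PairwiseDisjoint id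
/-- An absolute Borel space: a topological space homeomorphic to a Borel subset (with the
subspace topology) of some completely metrizable space. -/
def IsAbsoluteBorel (X : Type u) [TopologicalSpace X] : Prop :=
  ∃ (Z : Type u) (m : MetricSpace Z), letI := m;
    CompleteSpace Z ∧ ∃ B : Set Z, @MeasurableSet Z (borel Z) B ∧ Nonempty (X ≃ₜ B)

section Coding

open Filter Topology

/-- A map is σ-discrete on `S` if `S` splits into countably many pieces such that, on each piece,
points with different values are uniformly far apart. -/
def SigmaDiscreteOn {Z β : Type*} [MetricSpace Z] (S : Set Z) (g : Z → β) : Prop :=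
  ∃ m : Z → ℕ, ∀ x ∈ S, ∀ y ∈ S, m x = m y → dist x y < 1 / ((m x : ℝ) + 1) → g x = g y

theorem SigmaDiscreteOn.of_nat {Z : Type*} [MetricSpace Z] (S : Set Z) (g : Z → ℕ) :
    SigmaDiscreteOn S g :=
  ⟨g, fun _ _ _ _ h _ => h⟩

theorem SigmaDiscreteOn.comp {Z β γ : Type*} [MetricSpace Z] {S : Set Z} {g : Z → β}
    (hg : SigmaDiscreteOn S g) (f : β → γ) : SigmaDiscreteOn S (fun x => f (g x)) := by
  obtain ⟨m, hm⟩ := hg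
  exact ⟨m, fun x hx y hy h h' => congrArg f (hm x hx y hy h h')⟩

theorem SigmaDiscreteOn.mono {Z β : Type*} [MetricSpace Z] {S T : Set Z} {g : Z → β}
    (hg : SigmaDiscreteOn S g) (h : T ⊆ S) : SigmaDiscreteOn T g := by
  obtain ⟨m, hm⟩ := hg
  exact ⟨m, fun x hx y hy => hm x (h hx) y (h hy)⟩

theorem one_div_succ_le_of_le {a b : ℕ} (h : a ≤ b) :
    1 / ((b : ℝ) + 1) ≤ 1 / ((a : ℝ) + 1) := by
  gcongr

/-- If `g` is σ-discrete and `f` is σ-discrete on the fibres of `g`, then `f` is σ-discrete. -/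
theorem SigmaDiscreteOn.of_fibers {Z β γ : Type*} [MetricSpace Z] {S : Set Z} {g : Z → β}
    {f : Z → γ} (hg : SigmaDiscreteOn S g)
    (hf : ∀ b, SigmaDiscreteOn {x ∈ S | g x = b} f) : SigmaDiscreteOn S f := by
  obtain ⟨m, hm⟩ := hg
  choose l hl using hf
  refine ⟨fun x => Nat.pair (m x) (l (g x) x), fun x hx y hy h h' => ?_⟩
  have h1 := Nat.pair_eq_pair.1 h
  have hg : g x = g y :=
    hm x hx y hy h1.1 (h'.trans_le (one_div_succ_le_of_le (Nat.left_le_pair _ _)))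
  refine hl (g x) x ⟨hx, rfl⟩ y ⟨hy, hg.symm⟩ ?_
    (h'.trans_le (one_div_succ_le_of_le (Nat.right_le_pair _ _)))
  rw [h1.2, hg]

theorem SigmaDiscreteOn.prodMk {Z β γ : Type*} [MetricSpace Z] {S : Set Z} {g : Z → β}
    {f : Z → γ} (hg : SigmaDiscreteOn S g) (hf : SigmaDiscreteOn S f) :
    SigmaDiscreteOn S (fun x => (g x, f x)) := by
  refine hg.of_fibers fun b => ?_
  obtain ⟨m, hm⟩ := hf
  refine ⟨m, fun x hx y hy h h' => ?_⟩
  exact Prod.ext (hx.2.trans hy.2.symm) (hm x hx.1 y hy.1 h h')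

/-- The labels used to code points of a metric space. -/
abbrev CodeLabel (Z : Type*) : Type _ := List (Z ⊕ ℕ)

/-- `h` codes the points of `S` by sequences of labels: each coordinate is σ-discrete, the set of
codes is closed, and decoding is continuous. -/
structure IsCode {Z A : Type*} [MetricSpace Z] (S : Set Z) (h : Z → ℕ → A) : Prop where
  sigmaDiscrete : ∀ k, SigmaDiscreteOn S (fun x => h x k)
  lim : ∀ (x : ℕ → Z) (a : ℕ → A), (∀ n, x n ∈ S) → (∀ i, ∀ᶠ n in atTop, h (x n) i = a i) →
    ∃ y ∈ S, h y = a ∧ Tendsto x atTop (𝓝 y)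

theorem IsCode.injOn {Z A : Type*} [MetricSpace Z] {S : Set Z} {h : Z → ℕ → A}
    (H : IsCode S h) : Set.InjOn h S := by
  intro x hx y hy hxy
  obtain ⟨z, -, -, hz⟩ := H.lim (fun n => if Even n then x else y) (h x)
    (fun n => by split_ifs <;> assumption)
    (fun i => Eventually.of_forall fun n => by split_ifs <;> simp [hxy])
  have h1 : Tendsto (fun n : ℕ => 2 * n) atTop atTop :=
    tendsto_atTop_mono (fun n => by simp only [id]; lia) tendsto_id
  have h2 : Tendsto (fun n : ℕ => 2 * n + 1) atTop atTop :=
    tendsto_atTop_mono (fun n => by lia) h1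
  have h3 := hz.comp h1
  have h4 := hz.comp h2
  simp only [Function.comp_def, even_two, Even.mul_right, if_true] at h3
  have : ∀ n : ℕ, ¬ Even (2 * n + 1) := fun n => by simp
  simp only [Function.comp_def, this, if_false] at h4
  rw [tendsto_nhds_unique tendsto_const_nhds h3, tendsto_nhds_unique tendsto_const_nhds h4]

theorem IsCode.exists_cylinder {Z A : Type*} [MetricSpace Z] {S : Set Z} {h : Z → ℕ → A}
    (H : IsCode S h) {U : Set Z} (hU : IsOpen U) {x : Z} (hx : x ∈ S) (hxU : x ∈ U) :
    ∃ n, ∀ y ∈ S, (∀ i < n, h y i = h x i) → y ∈ U := by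
  by_contra! hc
  choose y hyS hy hyU using hc
  obtain ⟨z, hz, hzx, hlim⟩ := H.lim y (h x) hyS
    (fun i => (eventually_gt_atTop i).mono fun n hn => hy n i hn)
  rw [H.injOn hz hx hzx] at hlim
  obtain ⟨n, hn⟩ := (hlim.eventually (hU.mem_nhds hxU)).exists
  exact hyU n hn

/-- A set is coded if its points can be coded by sequences in `CodeLabel Z`. -/
def IsCoded {Z : Type*} [MetricSpace Z] (S : Set Z) : Prop :=
  ∃ h : Z → ℕ → CodeLabel Z, IsCode S h

theorem IsCoded.of_isClosed {Z : Type*} [MetricSpace Z] {S F : Set Z} (hS : IsCoded S)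
    (hF : IsClosed F) (hFS : F ⊆ S) : IsCoded F := by
  obtain ⟨h, H⟩ := hS
  refine ⟨h, fun k => (H.sigmaDiscrete k).mono hFS, fun x a hx hxa => ?_⟩
  obtain ⟨y, -, hy, hlim⟩ := H.lim x a (fun n => hFS (hx n)) hxa
  exact ⟨y, hF.mem_of_tendsto hlim (Eventually.of_forall hx), hy, hlim⟩

theorem eventually_cons_eq {Z : Type*} {p : ℕ → ℕ} {q : ℕ → ℕ → CodeLabel Z}
    {a : ℕ → CodeLabel Z}
    (h : ∀ i, ∀ᶠ n in atTop, Sum.inr (p n) :: q n i = a i) :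
    ∃ (N : ℕ) (a' : ℕ → CodeLabel Z), (∀ i, a i = Sum.inr N :: a' i) ∧
      (∀ᶠ n in atTop, p n = N) ∧ ∀ i, ∀ᶠ n in atTop, q n i = a' i := by
  choose k hk using fun i => (h i).exists
  refine ⟨p (k 0), fun i => q (k i) i, fun i => ?_, ?_, fun i => ?_⟩
  · obtain ⟨n, hn, hn0⟩ := ((h i).and (h 0)).exists
    have e1 := hn.trans (hk i).symm
    have e2 := hn0.trans (hk 0).symm
    simp only [List.cons.injEq, Sum.inr.injEq] at e1 e2
    rw [← hk i, ← e1.1, e2.1]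
  · filter_upwards [h 0] with n hn
    have e2 := hn.trans (hk 0).symm
    simp only [List.cons.injEq, Sum.inr.injEq] at e2
    exact e2.1
  · filter_upwards [h i] with n hn
    have e2 := hn.trans (hk i).symm
    simp only [List.cons.injEq, Sum.inr.injEq] at e2
    exact e2.2

theorem IsCoded.of_isOpen {Z : Type*} [MetricSpace Z] {U : Set Z}
    (hZ : IsCoded (univ : Set Z)) (hU : IsOpen U) : IsCoded U := by
  classical
  obtain ⟨h, H⟩ := hZ
  have hex : ∀ x ∈ U, ∃ n, ∀ y, (∀ i < n, h y i = h x i) → y ∈ U := fun x hx => by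
    simpa using H.exists_cylinder hU (mem_univ x) hx
  let lev : Z → ℕ := fun x =>
    if hx : ∃ n, ∀ y, (∀ i < n, h y i = h x i) → y ∈ U then Nat.find hx else 0
  have lev_spec : ∀ x ∈ U, ∀ y, (∀ i < lev x, h y i = h x i) → y ∈ U := by
    intro x hx
    have := hex x hx
    simp only [lev, this, dif_pos]
    exact Nat.find_spec this
  have lev_min : ∀ x n, (∀ y, (∀ i < n, h y i = h x i) → y ∈ U) → lev x ≤ n := by
    intro x n hn
    have : ∃ n, ∀ y, (∀ i < n, h y i = h x i) → y ∈ U := ⟨n, hn⟩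
    simp only [lev, this, dif_pos]
    exact Nat.find_min' this hn
  refine ⟨fun x i => Sum.inr (lev x) :: h x i, fun k => ?_, fun x a hx hxa => ?_⟩
  · exact ((SigmaDiscreteOn.of_nat U lev).prodMk
      ((H.sigmaDiscrete k).mono (subset_univ _))).comp fun p => Sum.inr p.1 :: p.2
  · obtain ⟨N, a', ha, hN, hq⟩ := eventually_cons_eq hxa
    obtain ⟨y, -, hy, hlim⟩ := H.lim x a' (fun _ => mem_univ _) hq
    have hagree : ∀ᶠ n in atTop, ∀ i < N, h (x n) i = h y i := by
      rw [hy]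
      have := (Set.finite_lt_nat N)
      simpa using (eventually_all_finite this).2 fun i _ => hq i
    obtain ⟨n, hnN, hn⟩ := (hN.and hagree).exists
    have hyU : y ∈ U := lev_spec (x n) (hx n) y (fun i hi => (hn i (hnN ▸ hi)).symm)
    refine ⟨y, hyU, ?_, hlim⟩
    have hle : lev y ≤ N := lev_min y N fun z hz =>
      lev_spec (x n) (hx n) z fun i hi => (hz i (hnN ▸ hi)).trans (hn i (hnN ▸ hi)).symm
    have hge : N ≤ lev y := by
      rw [← hnN]
      refine lev_min _ _ fun z hz => lev_spec y hyU z fun i hi => ?_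
      rw [hz i hi, hn i (hi.trans_le hle)]
    funext i
    rw [ha i, hy, le_antisymm hle hge]

theorem IsCoded.iUnion {Z : Type*} [MetricSpace Z] {S : ℕ → Set Z}
    (hd : Pairwise (Function.onFun Disjoint S)) (hS : ∀ n, IsCoded (S n)) :
    IsCoded (⋃ n, S n) := by
  classical
  choose h H using hS
  let p : Z → ℕ := fun x => if hx : ∃ n, x ∈ S n then hx.choose else 0
  have hp : ∀ x ∈ ⋃ n, S n, x ∈ S (p x) := by
    intro x hx
    have hx' : ∃ n, x ∈ S n := by simpa using hx
    simp only [p, hx', dif_pos]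
    exact hx'.choose_spec
  have hp' : ∀ x n, x ∈ S n → p x = n := by
    intro x n hx
    by_contra hne
    exact (Set.disjoint_left.1 (hd hne)) (hp x (mem_iUnion.2 ⟨n, hx⟩)) hx
  refine ⟨fun x i => Sum.inr (p x) :: h (p x) x i, fun k => ?_, fun x a hx hxa => ?_⟩
  · refine (SigmaDiscreteOn.of_nat _ p).of_fibers fun n => ?_
    obtain ⟨m, hm⟩ := (H n).sigmaDiscrete k
    refine ⟨m, fun x hx y hy e e' => ?_⟩
    have hxn : x ∈ S n := hx.2 ▸ hp x hx.1
    have hyn : y ∈ S n := hy.2 ▸ hp y hy.1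
    dsimp only
    rw [hx.2, hy.2]
    exact congrArg _ (hm x hxn y hyn e e')
  · obtain ⟨N, a', ha, hN, hq⟩ := eventually_cons_eq hxa
    obtain ⟨k, hk⟩ := eventually_atTop.1 hN
    have hsh : Tendsto (fun n : ℕ => n + k) atTop atTop := tendsto_add_atTop_nat k
    obtain ⟨y, hyS, hy, hlim⟩ := (H N).lim (fun n => x (n + k)) a'
      (fun n => hk (n + k) (by lia) ▸ hp _ (hx (n + k)))
      (fun i => by
        filter_upwards [hsh.eventually (hq i)] with n hn
        rwa [hk (n + k) (by lia)] at hn)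
    refine ⟨y, mem_iUnion.2 ⟨N, hyS⟩, ?_, (tendsto_add_atTop_iff_nat k).1 hlim⟩
    funext i
    rw [ha i, hp' y N hyS, hy]

theorem IsCoded.iInter {Z : Type*} [MetricSpace Z] {S : ℕ → Set Z}
    (hS : ∀ n, IsCoded (S n)) : IsCoded (⋂ n, S n) := by
  choose h H using hS
  refine ⟨fun x k => h k.unpair.1 x k.unpair.2, fun k => ?_, fun x a hx hxa => ?_⟩
  · exact ((H k.unpair.1).sigmaDiscrete k.unpair.2).mono (iInter_subset _ _)
  · have : ∀ n, ∃ y ∈ S n, h n y = (fun i => a (Nat.pair n i)) ∧ Tendsto x atTop (𝓝 y) :=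
      fun n => (H n).lim x _ (fun k => mem_iInter.1 (hx k) n) fun i => by
        simpa using hxa (Nat.pair n i)
    choose y hyS hy hlim using this
    have he : ∀ n, y n = y 0 := fun n => tendsto_nhds_unique (hlim n) (hlim 0)
    refine ⟨y 0, mem_iInter.2 fun n => he n ▸ hyS n, ?_, hlim 0⟩
    funext k
    rw [← he k.unpair.1, hy]
    simp

/-- Digits of a positive real number that determine it and whose limits detect positivity. -/
noncomputable def unitFractionDigit : ℕ → ℝ → ℕ
  | 0, r => ⌊1 / r⌋₊
  | j + 1, r => unitFractionDigit j (r - 1 / ((⌊1 / r⌋₊ : ℝ) + 1))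

theorem floor_one_div_eq_iff {r : ℝ} (hr : 0 < r) (q : ℕ) :
    ⌊1 / r⌋₊ = q ↔ q * r ≤ 1 ∧ 1 < (q + 1) * r := by
  rw [Nat.floor_eq_iff (by positivity), le_div_iff₀ hr, div_lt_iff₀ hr]

theorem sub_one_div_floor_pos {r : ℝ} (hr : 0 < r) :
    0 < r - 1 / ((⌊1 / r⌋₊ : ℝ) + 1) := by
  have := ((floor_one_div_eq_iff hr _).1 rfl).2
  rw [sub_pos, div_lt_iff₀ (by positivity)]
  linarith

theorem unitFractionDigit_lim_pos {r : ℕ → ℝ} {ρ : ℝ} {d : ℕ} (hr : ∀ k, 0 < r k)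
    (hlim : Tendsto r atTop (𝓝 ρ)) (hd : ∀ᶠ k in atTop, unitFractionDigit 0 (r k) = d) :
    0 < ρ := by
  have h : 1 ≤ ((d : ℝ) + 1) * ρ := by
    refine ge_of_tendsto (hlim.const_mul _) ?_
    filter_upwards [hd] with k hk
    exact ((floor_one_div_eq_iff (hr k) d).1 hk).2.le
  by_contra hc
  have : ((d : ℝ) + 1) * ρ ≤ 0 := mul_nonpos_of_nonneg_of_nonpos (by positivity) (not_lt.1 hc)
  linarith

theorem tendsto_sub_one_div_floor {r : ℕ → ℝ} {ρ : ℝ} {d : ℕ}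
    (hlim : Tendsto r atTop (𝓝 ρ)) (hd : ∀ᶠ k in atTop, unitFractionDigit 0 (r k) = d) :
    Tendsto (fun k => r k - 1 / ((⌊1 / r k⌋₊ : ℝ) + 1)) atTop (𝓝 (ρ - 1 / ((d : ℝ) + 1))) := by
  refine (hlim.sub_const _).congr' ?_
  filter_upwards [hd] with k hk
  rw [show ⌊1 / r k⌋₊ = d from hk]

theorem unitFractionDigit_zero_lim {r : ℕ → ℝ} {ρ : ℝ} {d : ℕ → ℕ} (hr : ∀ k, 0 < r k)
    (hlim : Tendsto r atTop (𝓝 ρ))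
    (hd : ∀ j, ∀ᶠ k in atTop, unitFractionDigit j (r k) = d j) : ⌊1 / ρ⌋₊ = d 0 := by
  rw [floor_one_div_eq_iff (unitFractionDigit_lim_pos hr hlim (hd 0))]
  constructor
  · refine le_of_tendsto (hlim.const_mul _) ?_
    filter_upwards [hd 0] with k hk
    exact ((floor_one_div_eq_iff (hr k) _).1 hk).1
  · have := unitFractionDigit_lim_pos (fun k => sub_one_div_floor_pos (hr k))
      (tendsto_sub_one_div_floor hlim (hd 0)) (hd 1)
    rw [sub_pos, div_lt_iff₀ (by positivity)] at this
    linarith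

theorem unitFractionDigit_lim {r : ℕ → ℝ} {ρ : ℝ} {d : ℕ → ℕ} (hr : ∀ k, 0 < r k)
    (hlim : Tendsto r atTop (𝓝 ρ))
    (hd : ∀ j, ∀ᶠ k in atTop, unitFractionDigit j (r k) = d j) (j : ℕ) :
    unitFractionDigit j ρ = d j := by
  induction j generalizing r ρ d with
  | zero => exact unitFractionDigit_zero_lim hr hlim hd
  | succ j ih =>
    have := ih (d := fun j => d (j + 1)) (fun k => sub_one_div_floor_pos (hr k))
      (tendsto_sub_one_div_floor hlim (hd 0)) fun j => hd (j + 1)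
    rw [unitFractionDigit, unitFractionDigit_zero_lim hr hlim hd, this]

theorem isCoded_univ (Z : Type*) [MetricSpace Z] [CompleteSpace Z] :
    IsCoded (univ : Set Z) := by
  have hpos : ∀ n : ℕ, (0 : ℝ) < 1 / ((n : ℝ) + 1) := fun n => by positivity
  have wf : WellFounded (WellOrderingRel (α := Z)) := WellOrderingRel.isWellOrder.wf
  have hne : ∀ (n : ℕ) (z : Z), {a | dist z a < 1 / ((n : ℝ) + 1)}.Nonempty :=
    fun n z => ⟨z, by simpa using hpos n⟩
  let α : ℕ → Z → Z := fun n z => wf.min _ (hne n z)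
  have hα : ∀ (n : ℕ) z, dist z (α n z) < 1 / ((n : ℝ) + 1) := fun n z => wf.min_mem _ (hne n z)
  have hmin : ∀ (n : ℕ) z a, dist z a < 1 / ((n : ℝ) + 1) → ¬ WellOrderingRel a (α n z) :=
    fun n z a ha => wf.not_lt_min _ ha
  let ρ : ℕ → Z → ℝ := fun n z => 1 / ((n : ℝ) + 1) - dist z (α n z)
  have hρ : ∀ n z, 0 < ρ n z := fun n z => sub_pos.2 (hα n z)
  have hαd : ∀ n, SigmaDiscreteOn univ (α n) := by
    intro n
    choose m hm using fun z => exists_nat_one_div_lt (hρ n z)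
    have key : ∀ x y, m x = m y → dist x y < 1 / ((m x : ℝ) + 1) →
        ¬ WellOrderingRel (α n x) (α n y) := by
      intro x y _ h
      refine hmin n y _ ?_
      have h1 := hm x
      have h2 := dist_triangle y x (α n x)
      rw [dist_comm y x] at h2
      simp only [ρ] at h1
      linarith
    refine ⟨m, fun x _ y _ h h' => ?_⟩
    rcases trichotomous_of WellOrderingRel (α n x) (α n y) with h1 | h1 | h1
    · exact absurd h1 (key x y h h')
    · exact h1
    · exact absurd h1 (key y x h.symm (by rwa [dist_comm, ← h]))
  refine ⟨fun z k => [Sum.inl (α k.unpair.1 z),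
    Sum.inr (unitFractionDigit k.unpair.2 (ρ k.unpair.1 z))], fun k => ?_, fun x a _ hxa => ?_⟩
  · exact ((hαd k.unpair.1).prodMk (SigmaDiscreteOn.of_nat _
      fun z => unitFractionDigit k.unpair.2 (ρ k.unpair.1 z))).comp
        fun p => [Sum.inl p.1, Sum.inr p.2]
  · have hab : ∀ n j, ∃ b d, a (Nat.pair n j) = [Sum.inl b, Sum.inr d] := fun n j => by
      obtain ⟨k, hk⟩ := (hxa (Nat.pair n j)).exists
      exact ⟨_, _, hk.symm⟩
    choose b d hbd using hab
    have hb : ∀ n j, ∀ᶠ k in atTop, α n (x k) = b n j ∧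
        unitFractionDigit j (ρ n (x k)) = d n j := by
      intro n j
      filter_upwards [hxa (Nat.pair n j)] with k hk
      simpa [hbd] using hk
    have hb0 : ∀ n j, b n j = b n 0 := fun n j => by
      obtain ⟨k, h1, h2⟩ := ((hb n j).and (hb n 0)).exists
      exact h1.1.symm.trans h2.1
    have hcau : CauchySeq x := by
      rw [Metric.cauchySeq_iff']
      intro ε hε
      obtain ⟨n, hn⟩ := exists_nat_one_div_lt (half_pos hε)
      obtain ⟨K, hK⟩ := eventually_atTop.1 (hb n 0)
      refine ⟨K, fun k hk => ?_⟩
      have h1 := hα n (x k)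
      have h2 := hα n (x K)
      rw [(hK k hk).1] at h1
      rw [(hK K le_rfl).1] at h2
      have := dist_triangle_right (x k) (x K) (b n 0)
      linarith
    obtain ⟨y, hlim⟩ := cauchySeq_tendsto_of_complete hcau
    refine ⟨y, mem_univ _, ?_, hlim⟩
    have hρlim : ∀ n, Tendsto (fun k => ρ n (x k)) atTop
        (𝓝 (1 / ((n : ℝ) + 1) - dist y (b n 0))) := by
      intro n
      refine ((hlim.dist tendsto_const_nhds).const_sub _).congr' ?_
      filter_upwards [hb n 0] with k hk
      simp only [ρ, hk.1]
    have hdig := fun n => unitFractionDigit_lim (fun k => hρ n (x k)) (hρlim n)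
      fun j => (hb n j).mono fun k hk => hk.2
    have hαy : ∀ n, α n y = b n 0 := by
      intro n
      have hp := unitFractionDigit_lim_pos (fun k => hρ n (x k)) (hρlim n)
        ((hb n 0).mono fun k hk => hk.2)
      have h1 := hmin n y (b n 0) (by linarith)
      have h2 : ∀ᶠ k in atTop, dist (x k) (α n y) < 1 / ((n : ℝ) + 1) :=
        (hlim.dist tendsto_const_nhds).eventually (gt_mem_nhds (hα n y))
      obtain ⟨k, hk, hk'⟩ := (h2.and (hb n 0)).exists
      have h3 := hmin n (x k) _ hk
      rw [hk'.1] at h3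
      rcases trichotomous_of WellOrderingRel (α n y) (b n 0) with h | h | h
      · exact absurd h h3
      · exact h
      · exact absurd h h1
    funext k
    have hk := hbd k.unpair.1 k.unpair.2
    rw [Nat.pair_unpair] at hk
    rw [hk, hb0, ← hαy, ← hdig, ← hαy]

theorem isCoded_of_measurableSet {Z : Type*} [MetricSpace Z] [CompleteSpace Z]
    [MeasurableSpace Z] [BorelSpace Z] {B : Set Z} (hB : MeasurableSet B) : IsCoded B := by
  suffices IsCoded B ∧ IsCoded Bᶜ from this.1
  have hZ := isCoded_univ Z
  induction B, hB using MeasurableSet.induction_on_open with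
  | isOpen U hU => exact ⟨hZ.of_isOpen hU, hZ.of_isClosed hU.isClosed_compl (subset_univ _)⟩
  | compl t ht ih => exact ⟨ih.2, by rw [compl_compl]; exact ih.1⟩
  | iUnion f hd hf ih =>
    refine ⟨IsCoded.iUnion hd fun n => (ih n).1, ?_⟩
    rw [compl_iUnion]
    exact IsCoded.iInter fun n => (ih n).2

end Coding

section Decomposition

open Filter Topology

/-- A subset of `X` is a Cantor set if it is the image of a continuous injection of the Cantor
space. -/
def IsCantorSet {X : Type*} [TopologicalSpace X] (K : Set X) : Prop :=
  ∃ f : CantorSpace → X, Continuous f ∧ Function.Injective f ∧ range f = K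

/-- A set is Cantor decomposable if it is a disjoint union of Cantor sets. -/
def CantorDecomposable {X : Type*} [TopologicalSpace X] (S : Set X) : Prop :=
  ∃ Q : Set (Set X), (∀ K ∈ Q, IsCantorSet K) ∧ Q.PairwiseDisjoint id ∧ ⋃₀ Q = S

theorem IsCantorSet.cantorDecomposable {X : Type*} [TopologicalSpace X] {K : Set X}
    (hK : IsCantorSet K) : CantorDecomposable K :=
  ⟨{K}, by simpa using hK, pairwiseDisjoint_singleton _ _, sUnion_singleton K⟩

theorem CantorDecomposable.empty {X : Type*} [TopologicalSpace X] :
    CantorDecomposable (∅ : Set X) :=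
  ⟨∅, by simp, by simp, sUnion_empty⟩

theorem CantorDecomposable.iUnion {X ι : Type*} [TopologicalSpace X] {S : ι → Set X}
    (hd : Pairwise (Function.onFun Disjoint S)) (hS : ∀ i, CantorDecomposable (S i)) :
    CantorDecomposable (⋃ i, S i) := by
  choose Q hQ hQd hQS using hS
  refine ⟨⋃ i, Q i, ?_, ?_, ?_⟩
  · rintro K hK
    obtain ⟨i, hi⟩ := mem_iUnion.1 hK
    exact hQ i K hi
  · rintro K hK L hL hne
    obtain ⟨i, hi⟩ := mem_iUnion.1 hK
    obtain ⟨j, hj⟩ := mem_iUnion.1 hL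
    by_cases hij : i = j
    · subst hij
      exact hQd i hi hj hne
    · exact (hd hij).mono (hQS i ▸ subset_sUnion_of_mem hi) (hQS j ▸ subset_sUnion_of_mem hj)
  · rw [sUnion_iUnion]
    exact iUnion_congr hQS

theorem CantorDecomposable.union {X : Type*} [TopologicalSpace X] {S T : Set X}
    (hd : Disjoint S T) (hS : CantorDecomposable S) (hT : CantorDecomposable T) :
    CantorDecomposable (S ∪ T) := by
  rw [union_eq_iUnion]
  refine CantorDecomposable.iUnion ?_ ?_
  · rintro (_ | _) (_ | _) h <;> simp_all [Function.onFun, hd.symm]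
  · rintro (_ | _) <;> simpa

/-- A set is almost decomposable if it is Cantor decomposable up to a σ-discrete subset. -/
def AlmostDecomposable {X : Type*} [MetricSpace X] (S : Set X) : Prop :=
  ∃ D ⊆ S, SigmaDiscreteOn D (fun x => x) ∧ CantorDecomposable (S \ D)

theorem CantorDecomposable.almostDecomposable {X : Type*} [MetricSpace X] {S : Set X}
    (hS : CantorDecomposable S) : AlmostDecomposable S :=
  ⟨∅, empty_subset _, ⟨fun _ => 0, by simp⟩, by simpa⟩

theorem AlmostDecomposable.of_subsingleton {X : Type*} [MetricSpace X] {S : Set X}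
    (hS : S.Subsingleton) : AlmostDecomposable S :=
  ⟨S, subset_rfl, ⟨fun _ => 0, fun _ hx _ hy _ _ => hS hx hy⟩,
    by simpa using CantorDecomposable.empty⟩

theorem AlmostDecomposable.union {X : Type*} [MetricSpace X] {S T : Set X}
    (hd : Disjoint S T) (hS : AlmostDecomposable S) (hT : AlmostDecomposable T) :
    AlmostDecomposable (S ∪ T) := by
  classical
  obtain ⟨D, hDS, hD, hSD⟩ := hS
  obtain ⟨E, hET, hE, hTE⟩ := hT
  refine ⟨D ∪ E, union_subset_union hDS hET, ?_, ?_⟩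
  · refine (SigmaDiscreteOn.of_nat (D ∪ E) fun x => if x ∈ S then 0 else 1).of_fibers fun b => ?_
    by_cases hb : b = 0
    · refine hD.mono ?_
      rintro x ⟨hx | hx, h⟩
      · exact hx
      · have := disjoint_right.1 hd (hET hx)
        simp [this] at h
        omega
    · refine hE.mono ?_
      rintro x ⟨hx | hx, h⟩
      · simp [hDS hx] at h
        omega
      · exact hx
  · have : (S ∪ T) \ (D ∪ E) = (S \ D) ∪ (T \ E) := by
      ext x
      have h1 := @hDS x
      have h2 := @hET x
      have h3 := @disjoint_left.1 hd x
      simp only [Set.mem_sdiff, mem_union]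
      tauto
    rw [this]
    exact hSD.union (hd.mono sdiff_subset sdiff_subset) hTE

/-- `c n x` is the label of the level `n` cylinder of `x`, in a coding of the space `X`. -/
structure IsLevelCode {X A : Type*} [MetricSpace X] (c : ℕ → X → A) : Prop where
  mono : ∀ {m n}, m ≤ n → ∀ {x y}, c n x = c n y → c m x = c m y
  sigmaDiscrete : ∀ n, SigmaDiscreteOn univ (c n)
  lim : ∀ (x : ℕ → X) (a : ℕ → A), (∀ n, ∀ᶠ k in atTop, c n (x k) = a n) →
    ∃ y, (∀ n, c n y = a n) ∧ Tendsto x atTop (𝓝 y)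
  inj : ∀ {x y}, (∀ n, c n x = c n y) → x = y

theorem AlmostDecomposable.of_cylinders {X A : Type*} [MetricSpace X] {c : ℕ → X → A}
    (H : IsLevelCode c) {S : Set X}
    (hS : ∀ x ∈ S, ∃ n, AlmostDecomposable {y | c n y = c n x} ∧ {y | c n y = c n x} ⊆ S) :
    AlmostDecomposable S := by
  classical
  choose! D hDC hD hCD using fun (C : Set X) (h : AlmostDecomposable C) => h
  let n : X → ℕ := fun x => if h : ∃ n, AlmostDecomposable {y | c n y = c n x} ∧
    {y | c n y = c n x} ⊆ S then Nat.find h else 0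
  let N : X → Set X := fun x => {y | c (n x) y = c (n x) x}
  have hn : ∀ x ∈ S, AlmostDecomposable (N x) ∧ N x ⊆ S := by
    intro x hx
    have h := hS x hx
    have e : n x = Nat.find h := dif_pos h
    simp only [N, e]
    exact Nat.find_spec h
  have hmin : ∀ x k, AlmostDecomposable {y | c k y = c k x} → {y | c k y = c k x} ⊆ S →
      n x ≤ k := by
    intro x k h1 h2
    have h : ∃ n, AlmostDecomposable {y | c n y = c n x} ∧ {y | c n y = c n x} ⊆ S := ⟨k, h1, h2⟩
    have e : n x = Nat.find h := dif_pos h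
    rw [e]
    exact Nat.find_min' h ⟨h1, h2⟩
  have hself : ∀ x, x ∈ N x := fun x => rfl
  have hcyl : ∀ {k x y}, c k y = c k x → {z | c k z = c k y} = {z | c k z = c k x} := by
    intro k x y h
    simp only [h]
  have hNeq : ∀ x ∈ S, ∀ y ∈ N x, n y = n x ∧ N y = N x := by
    intro x hx y hy
    have h1 : n y ≤ n x := hmin y (n x) (by rw [hcyl hy]; exact (hn x hx).1)
      (by rw [hcyl hy]; exact (hn x hx).2)
    have hyS : y ∈ S := (hn x hx).2 hy
    have hxy : c (n y) x = c (n y) y := (H.mono h1 hy).symm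
    have h2 : n x ≤ n y := hmin x (n y) (by rw [hcyl hxy]; exact (hn y hyS).1)
      (by rw [hcyl hxy]; exact (hn y hyS).2)
    have he := le_antisymm h1 h2
    refine ⟨he, ?_⟩
    simp only [N, he]
    exact hcyl hy
  have hDN : ∀ x ∈ S, D (N x) ⊆ N x := fun x hx => hDC _ (hn x hx).1
  refine ⟨{x ∈ S | x ∈ D (N x)}, fun x hx => hx.1, ?_, ?_⟩
  · refine (SigmaDiscreteOn.of_nat _ n).of_fibers fun k => ?_
    refine ((H.sigmaDiscrete k).mono (subset_univ _)).of_fibers fun a => ?_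
    rcases Set.eq_empty_or_nonempty {x ∈ {x ∈ {x ∈ S | x ∈ D (N x)} | n x = k} | c k x = a}
      with he | ⟨x, ⟨⟨hxS, hx⟩, hxk⟩, hxa⟩
    · rw [he]
      exact ⟨fun _ => 0, by simp⟩
    · refine (hD _ (hn x hxS).1).mono ?_
      rintro y ⟨⟨⟨hyS, hy⟩, hyk⟩, hya⟩
      have : y ∈ N x := by
        change c (n x) y = c (n x) x
        rw [hxk, hya, hxa]
      rwa [(hNeq x hxS y this).2] at hy
  · have : S \ {x ∈ S | x ∈ D (N x)} = ⋃ C : N '' S, (C.1 \ D C.1) := by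
      ext y
      simp only [Set.mem_sdiff, mem_iUnion, Subtype.exists, mem_image]
      constructor
      · rintro ⟨hy, hyD⟩
        exact ⟨N y, ⟨y, hy, rfl⟩, hself y, fun h => hyD ⟨hy, h⟩⟩
      · rintro ⟨C, ⟨x, hx, rfl⟩, hy, hyD⟩
        refine ⟨(hn x hx).2 hy, fun h => hyD ?_⟩
        rw [← (hNeq x hx y hy).2]
        exact h.2
    rw [this]
    refine CantorDecomposable.iUnion ?_ ?_
    · rintro ⟨_, x, hx, rfl⟩ ⟨_, y, hy, rfl⟩ hne
      refine Disjoint.mono sdiff_subset sdiff_subset (disjoint_left.2 fun z hz hz' => hne ?_)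
      exact Subtype.ext ((hNeq x hx z hz).2.symm.trans (hNeq y hy z hz').2)
    · rintro ⟨_, x, hx, rfl⟩
      exact hCD _ (hn x hx).1

theorem exists_splitting_map {X Λ : Type*} (𝒩 : ℕ → Set X → Prop) (V : Set X) (h0 : 𝒩 0 V)
    (hs : ∀ n C, 𝒩 n C → ∃ l : X → Λ, ∀ a, 𝒩 (n + 1) {x ∈ C | l x = a}) :
    ∃ Φ : X → ℕ → Λ, ∀ n (a : ℕ → Λ), 𝒩 n {z ∈ V | ∀ i < n, Φ z i = a i} := by
  classical
  have : Nonempty (X → Λ) := ⟨(hs 0 V h0).choose⟩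
  choose! l hl using hs
  let E : (ℕ → Λ) → ℕ → Set X := fun a n => Nat.rec V (fun i C => {x ∈ C | l i C x = a i}) n
  have hE : ∀ a n, 𝒩 n (E a n) := by
    intro a n
    induction n with
    | zero => exact h0
    | succ n ih => exact hl n _ ih (a n)
  let D : X → ℕ → Set X := fun z n => Nat.rec V (fun i C => {x ∈ C | l i C x = l i C z}) n
  let Φ : X → ℕ → Λ := fun z n => l n (D z n) z
  have hDE : ∀ z a n, (∀ i < n, Φ z i = a i) → D z n = E a n := by
    intro z a n h
    induction n with
    | zero => rfl
    | succ n ih =>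
      have e := ih fun i hi => h i (by lia)
      have e' := h n (by lia)
      change {x ∈ D z n | l n (D z n) x = Φ z n} = {x ∈ E a n | l n (E a n) x = a n}
      rw [e, e']
  refine ⟨Φ, fun n a => ?_⟩
  convert hE a n using 1
  induction n with
  | zero => simp [E]
  | succ n ih =>
    ext z
    have ih' : z ∈ V ∧ (∀ i < n, Φ z i = a i) ↔ z ∈ E a n := by rw [← ih]; rfl
    change z ∈ V ∧ (∀ i < n + 1, Φ z i = a i) ↔ z ∈ E a n ∧ l n (E a n) z = a n
    rw [← ih', Nat.forall_lt_succ_right]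
    constructor
    · rintro ⟨hz, h1, h2⟩
      refine ⟨⟨hz, h1⟩, ?_⟩
      rw [← hDE z a n h1]
      exact h2
    · rintro ⟨⟨hz, h1⟩, h2⟩
      refine ⟨hz, h1, ?_⟩
      rw [← hDE z a n h1] at h2
      exact h2

/-- A set is closed with respect to the cylinders of a level code. -/
def IsLevelClosed {X A : Type*} (c : ℕ → X → A) (V : Set X) : Prop :=
  ∀ (y : X) (x : ℕ → X), (∀ n, x n ∈ V) → (∀ n, c n y = c n (x n)) → y ∈ V

theorem exists_scheme_bijection {X A Λ : Type*} [MetricSpace X] {c : ℕ → X → A}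
    (H : IsLevelCode c) {V : Set X} (hV : IsLevelClosed c V) (𝒩 : ℕ → Set X → Prop)
    (h0 : 𝒩 0 V)
    (hs : ∀ n C, 𝒩 n C → ∃ l : X → Λ, ∀ a, 𝒩 (n + 1) {x ∈ C | l x = a})
    (hne : ∀ n C, 𝒩 n C → C.Nonempty)
    (hcl : ∀ n C, 𝒩 n C → ∃ k, ∀ x ∈ C, ∀ y ∈ V, c k y = c k x → y ∈ C)
    (hsm : ∀ k, ∃ n, ∀ C, 𝒩 n C → ∀ x ∈ C, ∀ y ∈ C, c k x = c k y) :
    ∃ g : (ℕ → Λ) → X, Function.Injective g ∧ range g = V ∧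
      ∀ k, ∃ n, ∀ a b : ℕ → Λ, (∀ i < n, a i = b i) → c k (g a) = c k (g b) := by
  obtain ⟨Φ, hΦ⟩ := exists_splitting_map 𝒩 V h0 hs
  choose N hN using hsm
  have key : ∀ a : ℕ → Λ, ∃ y ∈ V, ∀ i, Φ y i = a i := by
    intro a
    choose z hz using fun n => hne n _ (hΦ n a)
    have hsub : ∀ {m n}, m ≤ n → z n ∈ {z ∈ V | ∀ i < m, Φ z i = a i} := fun {m n} h =>
      ⟨(hz n).1, fun i hi => (hz n).2 i (hi.trans_le h)⟩
    have hc : ∀ k n, N k ≤ n → c k (z n) = c k (z (N k)) := fun k n h =>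
      hN k _ (hΦ _ a) _ (hsub h) _ (hsub le_rfl)
    obtain ⟨y, hy, -⟩ := H.lim z (fun k => c k (z (N k)))
      fun k => (eventually_ge_atTop (N k)).mono fun n hn => hc k n hn
    have hyV : y ∈ V := hV y (fun k => z (N k)) (fun k => (hz _).1) hy
    refine ⟨y, hyV, fun i => ?_⟩
    obtain ⟨k, hk⟩ := hcl _ _ (hΦ (i + 1) a)
    exact (hk (z (max (i + 1) (N k))) (hsub (le_max_left _ _)) y hyV
      ((hy k).trans (hc k _ (le_max_right _ _)).symm)).2 i (by lia)
  choose g hgV hg using key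
  have hg' : ∀ a, Φ (g a) = a := fun a => funext (hg a)
  refine ⟨g, Function.LeftInverse.injective hg', ?_, fun k => ⟨N k, fun a b hab => ?_⟩⟩
  · refine Subset.antisymm (range_subset_iff.2 hgV) fun z hz => ⟨Φ z, H.inj fun k => ?_⟩
    exact hN k _ (hΦ _ (Φ z)) _ ⟨hgV _, fun i _ => hg _ i⟩ _ ⟨hz, fun i _ => rfl⟩
  · exact hN k _ (hΦ _ a) _ ⟨hgV _, fun i _ => hg _ i⟩ _
      ⟨hgV _, fun i hi => (hg _ i).trans (hab i hi).symm⟩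

theorem isCantorSet_range_of_level {X A : Type*} [MetricSpace X] {c : ℕ → X → A}
    (H : IsLevelCode c) {f : CantorSpace → X} (hf : Function.Injective f)
    (hc : ∀ k, ∃ n, ∀ a b : CantorSpace, (∀ i < n, a i = b i) → c k (f a) = c k (f b)) :
    IsCantorSet (range f) := by
  refine ⟨f, continuous_iff_seqContinuous.2 fun b b₀ hb => ?_, hf, rfl⟩
  obtain ⟨y, hy, hlim⟩ := H.lim (f ∘ b) (fun n => c n (f b₀)) fun k => by
    obtain ⟨n, hn⟩ := hc k
    have : ∀ᶠ j in atTop, ∀ i < n, b j i = b₀ i := by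
      have := (eventually_all_finite (Set.finite_lt_nat n) (l := atTop)
        (p := fun i j => b j i = b₀ i)).2 fun i _ => by
          have h1 := (tendsto_pi_nhds.1 hb) i
          rw [nhds_discrete, tendsto_pure] at h1
          exact h1
      simpa using this
    exact this.mono fun j hj => hn _ _ hj
  rwa [H.inj hy] at hlim

end Decomposition

section Trees

open Filter Topology

theorem isCantorSet_of_finite_levels {X A : Type*} [MetricSpace X] {c : ℕ → X → A}
    (H : IsLevelCode c) {V : Set X} (hV : IsLevelClosed c V) (hne : V.Nonempty)
    (hfin : ∀ n, (c n '' V).Finite) (hperf : ∀ x ∈ V, ∀ n, ∃ y ∈ V, c n y = c n x ∧ y ≠ x) :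
    IsCantorSet V := by
  classical
  obtain ⟨e, he⟩ : ∃ e : ℕ → ℕ × A, (⋃ n, Prod.mk n '' (c n '' V)) = range e := by
    refine Set.Countable.exists_eq_range (countable_iUnion fun n => ((hfin n).image _).countable) ?_
    obtain ⟨x, hx⟩ := hne
    exact ⟨(0, c 0 x), mem_iUnion.2 ⟨0, _, ⟨x, hx, rfl⟩, rfl⟩⟩
  have he' : ∀ k, ∀ x ∈ V, ∃ j, e j = (k, c k x) := fun k x hx => by
    have : (k, c k x) ∈ range e := he ▸ mem_iUnion.2 ⟨k, _, ⟨x, hx, rfl⟩, rfl⟩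
    exact this
  let 𝒩 : ℕ → Set X → Prop := fun n C => C ⊆ V ∧ C.Nonempty ∧
    (∃ k, ∀ x ∈ C, ∀ y ∈ V, c k y = c k x → y ∈ C) ∧
    ∀ j < n, ∀ x ∈ C, ∀ y ∈ C, c (e j).1 x = (e j).2 → c (e j).1 y = (e j).2
  have hsm : ∀ k, ∃ n, ∀ C, 𝒩 n C → ∀ x ∈ C, ∀ y ∈ C, c k x = c k y := by
    intro k
    have : ∀ a ∈ c k '' V, ∃ j, e j = (k, a) := by
      rintro _ ⟨x, hx, rfl⟩
      exact he' k x hx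
    choose! J hJ using this
    obtain ⟨n, hn⟩ := ((hfin k).image J).bddAbove
    refine ⟨n + 1, fun C hC x hx y hy => ?_⟩
    have hxV := hC.1 hx
    have h1 := hJ _ (mem_image_of_mem (c k) hxV)
    have h2 : J (c k x) ≤ n := hn (mem_image_of_mem J (mem_image_of_mem (c k) hxV))
    have h3 := hC.2.2.2 (J (c k x)) (by lia) x hx y hy
    rw [h1] at h3
    exact (h3 rfl).symm
  have hs : ∀ n C, 𝒩 n C → ∃ l : X → Bool, ∀ a, 𝒩 (n + 1) {x ∈ C | l x = a} := by
    rintro n C ⟨hCV, hCne, ⟨k, hk⟩, hj⟩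
    have main : ∀ (m : ℕ) (b : A), (∃ x ∈ C, c m x = b) → (∃ y ∈ C, c m y ≠ b) →
        (∀ d : Bool, ∀ x ∈ C, ∀ y ∈ C, decide (c m x = b) = d → decide (c m y = b) = d →
          c (e n).1 x = (e n).2 → c (e n).1 y = (e n).2) →
        ∃ l : X → Bool, ∀ a, 𝒩 (n + 1) {x ∈ C | l x = a} := by
      rintro m b ⟨x, hx, hxb⟩ ⟨y, hy, hyb⟩ hsep
      refine ⟨fun z => decide (c m z = b), fun d =>
        ⟨fun z hz => hCV hz.1, ?_, ⟨max k m, ?_⟩, ?_⟩⟩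
      · cases d
        · exact ⟨y, hy, by simpa using hyb⟩
        · exact ⟨x, hx, by simpa using hxb⟩
      · rintro z ⟨hz, hzd⟩ w hw hwz
        refine ⟨hk z hz w hw (H.mono (le_max_left _ _) hwz), ?_⟩
        have e := H.mono (le_max_right k m) hwz
        simpa only [mem_ofPred_eq, e] using hzd
      · intro j hjn z hz w hw
        rcases Nat.lt_succ_iff_lt_or_eq.1 hjn with h | rfl
        · exact hj j h z hz.1 w hw.1
        · exact hsep d z hz.1 w hw.1 hz.2 hw.2
    by_cases hsp : (∃ x ∈ C, c (e n).1 x = (e n).2) ∧ ∃ y ∈ C, c (e n).1 y ≠ (e n).2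
    · refine main _ _ hsp.1 hsp.2 fun d x hx y hy h1 h2 h3 => ?_
      rw [← h2] at h1
      simpa [h3] using h1
    · obtain ⟨x, hx⟩ := hCne
      obtain ⟨y, hyV, hyx, hne⟩ := hperf x (hCV hx) k
      have hy := hk x hx y hyV hyx
      obtain ⟨m, hm⟩ : ∃ m, c m y ≠ c m x := by
        by_contra! h
        exact hne (H.inj h)
      refine main m (c m x) ⟨x, hx, rfl⟩ ⟨y, hy, hm⟩ fun d z hz w hw _ _ h => ?_
      by_contra h'
      exact hsp ⟨⟨z, hz, h⟩, w, hw, h'⟩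
  obtain ⟨g, hg, rfl, hgc⟩ := exists_scheme_bijection H hV 𝒩
    ⟨subset_rfl, hne, ⟨0, fun _ _ y hy _ => hy⟩, by simp⟩ hs (fun n C h => h.2.1)
    (fun n C h => h.2.2.1) hsm
  exact isCantorSet_range_of_level H hg hgc

theorem cantorDecomposable_range_of_level {X A : Type*} [MetricSpace X] {c : ℕ → X → A}
    (H : IsLevelCode c) {Λ : Type*} [Infinite Λ] {g : (ℕ → Λ) → X} (hg : Function.Injective g)
    (hc : ∀ k, ∃ n, ∀ a b : ℕ → Λ, (∀ i < n, a i = b i) → c k (g a) = c k (g b)) :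
    CantorDecomposable (range g) := by
  have : Nonempty (Λ ≃ Λ × Bool) := by
    rw [← Cardinal.eq]
    simp only [mk_prod, mk_fintype, Fintype.card_bool, Nat.cast_ofNat, Cardinal.lift_ofNat,
      Cardinal.lift_uzero]
    rw [Cardinal.mul_eq_left (aleph0_le_mk Λ) (ofNat_lt_aleph0.le.trans (aleph0_le_mk Λ))
      (by norm_num)]
  obtain ⟨e⟩ := this
  let G : (ℕ → Λ) → CantorSpace → X := fun y b => g fun i => e.symm (y i, b i)
  have hG : ∀ y z b d, G y b = G z d → y = z ∧ b = d := by
    intro y z b d h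
    have h1 := fun i => congrFun (hg h) i
    simp only [EmbeddingLike.apply_eq_iff_eq, Prod.mk.injEq] at h1
    exact ⟨funext fun i => (h1 i).1, funext fun i => (h1 i).2⟩
  have : range g = ⋃ y, range (G y) := by
    ext x
    simp only [mem_range, mem_iUnion]
    constructor
    · rintro ⟨a, rfl⟩
      exact ⟨fun i => (e (a i)).1, fun i => (e (a i)).2, by simp [G]⟩
    · rintro ⟨y, b, rfl⟩
      exact ⟨_, rfl⟩
  rw [this]
  refine CantorDecomposable.iUnion (fun y z hyz => disjoint_left.2 ?_) fun y => ?_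
  · rintro _ ⟨b, rfl⟩ ⟨d, h⟩
    exact hyz (hG _ _ _ _ h).1.symm
  · refine (isCantorSet_range_of_level H (f := G y) (fun b d h => (hG _ _ _ _ h).2)
      fun k => ?_).cantorDecomposable
    obtain ⟨n, hn⟩ := hc k
    exact ⟨n, fun a b hab => hn _ _ fun i hi => by rw [hab i hi]⟩

/-- The set of all cylinder labels, at all levels, of points of `C`. -/
def levelNodes {X A : Type*} (c : ℕ → X → A) (C : Set X) : Set (ℕ × A) :=
  {p | ∃ z ∈ C, c p.1 z = p.2}

theorem levelNodes_mono {X A : Type*} (c : ℕ → X → A) {C D : Set X} (h : C ⊆ D) :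
    levelNodes c C ⊆ levelNodes c D :=
  fun _ ⟨z, hz, e⟩ => ⟨z, h hz, e⟩

theorem mk_levelNodes_le {X : Type*} {A : Type u} (c : ℕ → X → A) (C : Set X) {μ : Cardinal.{u}}
    (h : ∀ n, #(c n '' C) ≤ μ) : #(levelNodes c C) ≤ ℵ₀ * μ := by
  have : levelNodes c C = ⋃ i : ULift.{u} ℕ, Prod.mk i.down '' (c i.down '' C) := by
    ext ⟨n, a⟩
    simp [levelNodes]
  rw [this]
  refine (mk_iUnion_le _).trans ?_
  gcongr
  · simp
  · exact ciSup_le' fun i => mk_image_le.trans (h i.down)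

theorem mk_image_le_of_mono {X : Type*} {A : Type u} {c : ℕ → X → A} {m n : ℕ}
    (h : ∀ x y, c n x = c n y → c m x = c m y) (C : Set X) :
    #(c m '' C) ≤ #(c n '' C) := by
  refine mk_le_of_injective (f := fun a : c m '' C => ⟨c n a.2.choose, _, a.2.choose_spec.1, rfl⟩) ?_
  intro a b hab
  have h1 := h _ _ (congrArg Subtype.val hab)
  exact Subtype.ext (by rw [← a.2.choose_spec.2, ← b.2.choose_spec.2, h1])

theorem mk_image_le_mk_levelNodes {X : Type*} {A : Type u} (c : ℕ → X → A) (n : ℕ) (C : Set X) :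
    #(c n '' C) ≤ #(levelNodes c C) := by
  refine mk_le_of_injective (f := fun a : c n '' C => ⟨(n, a.1), a.2⟩) ?_
  intro a b hab
  have := congrArg Subtype.val hab
  simp only [Prod.mk.injEq, true_and] at this
  exact Subtype.ext this

/-- The cylinder of `y` of level `n` inside `F`. -/
def levelCylinder {X A : Type*} (c : ℕ → X → A) (F : Set X) (y : X) (n : ℕ) : Set X :=
  {z ∈ F | c n z = c n y}

/-- A cylinder all of whose subcylinders have the same number `λ` of nodes and some infinite level
can be partitioned into `λ` cylinders of large level. -/
theorem exists_partition_level {X : Type*} {A : Type u} [MetricSpace X] {c : ℕ → X → A}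
    (H : IsLevelCode c) {F C : Set X} {y : X} {k : ℕ} (hy : y ∈ F)
    (hC : C = levelCylinder c F y k)
    (hwt : ∀ z ∈ C, ∀ j ≥ k, #(levelNodes c (levelCylinder c F z j)) = #(levelNodes c C))
    (hinf : ∀ z ∈ C, ∀ j ≥ k, ∃ i, (c i '' levelCylinder c F z j).Infinite) (n : ℕ) :
    ∃ L : X → ℕ, (∀ z ∈ C, n ≤ L z ∧ k ≤ L z) ∧
      (∀ z ∈ C, ∀ w ∈ C, c (L z) w = c (L z) z → L w = L z) ∧
      #(levelNodes c C) = #((fun z => (L z, c (L z) z)) '' C) := by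
  classical
  have hup : ∀ (L : X → ℕ), #((fun z => (L z, c (L z) z)) '' C) ≤ #(levelNodes c C) := by
    intro L
    refine mk_le_mk_of_subset ?_
    rintro _ ⟨z, hz, rfl⟩
    exact ⟨z, hz, rfl⟩
  have hyC : y ∈ C := hC ▸ ⟨hy, rfl⟩
  have hmono : ∀ {i j : ℕ}, i ≤ j → ∀ D : Set X, #(c i '' D) ≤ #(c j '' D) :=
    fun hij D => mk_image_le_of_mono (fun _ _ => H.mono hij) D
  obtain ⟨k₁, hk₁n, hk₁k, hk₁⟩ : ∃ k₁, n ≤ k₁ ∧ k ≤ k₁ ∧ ℵ₀ ≤ #(c k₁ '' C) := by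
    obtain ⟨i, hi⟩ := hinf y hyC k le_rfl
    rw [← hC, ← Set.infinite_coe_iff, Cardinal.infinite_iff] at hi
    exact ⟨max i (max n k), by lia, by lia, hi.trans (hmono (le_max_left _ _) C)⟩
  by_cases hA : ∃ j, #(levelNodes c C) ≤ #(c j '' C)
  · obtain ⟨j, hj⟩ := hA
    refine ⟨fun _ => max j k₁, fun _ _ => ⟨by lia, by lia⟩, fun _ _ _ _ _ => rfl,
      le_antisymm ?_ (hup _)⟩
    refine (hj.trans (hmono (le_max_left j k₁) C)).trans ?_
    have : (fun z => (max j k₁, c (max j k₁) z)) '' C = Prod.mk (max j k₁) '' (c (max j k₁) '' C) := by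
      rw [image_image]
    rw [this, mk_image_eq (Prod.mk_right_injective _)]
  · push Not at hA
    have hlt : ℵ₀ < #(levelNodes c C) := hk₁.trans_lt (hA k₁)
    have hj : ∀ i, ∀ z ∈ C, ∃ j ≥ k₁, #(c i '' C) ≤ #(c j '' levelCylinder c F z k₁) := by
      intro i z hz
      by_contra! h
      have h' : ∀ j, #(c j '' levelCylinder c F z k₁) ≤ #(c i '' C) := by
        intro j
        refine (hmono (le_max_left j k₁) _).trans (h _ (le_max_right _ _)).le
      have h1 := mk_levelNodes_le c _ h'
      rw [hwt z hz k₁ hk₁k] at h1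
      exact absurd h1 (not_le.2 (mul_lt_of_lt hlt.le hlt (hA i)))
    choose! J hJk hJ using hj
    have : Infinite (c k₁ '' C) := Cardinal.infinite_iff.2 hk₁
    let s : ℕ → c k₁ '' C := Infinite.natEmbedding _
    have hsi : Function.Injective s := (Infinite.natEmbedding _).injective
    choose z hzC hz using fun i => (s i).2
    let L : X → ℕ := fun w => if h : ∃ i, c k₁ w = c k₁ (z i) then J h.choose (z h.choose) else k₁
    have hLi : ∀ w i, c k₁ w = c k₁ (z i) → L w = J i (z i) := by
      intro w i hw
      have h : ∃ i, c k₁ w = c k₁ (z i) := ⟨i, hw⟩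
      have e : h.choose = i :=
        hsi (Subtype.ext ((hz _).symm.trans ((h.choose_spec.symm.trans hw).trans (hz i))))
      simp only [L, dif_pos h, e]
    have hLk : ∀ w, k₁ ≤ L w := by
      intro w
      by_cases h : ∃ i, c k₁ w = c k₁ (z i)
      · obtain ⟨i, hi⟩ := h
        rw [hLi w i hi]
        exact hJk i _ (hzC i)
      · simp only [L, dif_neg h, le_refl]
    have hLc : ∀ w x, c k₁ w = c k₁ x → L w = L x := by
      intro w x h
      simp only [L, h]
    refine ⟨L, fun w _ => ⟨hk₁n.trans (hLk w), hk₁k.trans (hLk w)⟩,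
      fun x _ w _ h => hLc _ _ (H.mono (hLk x) h), le_antisymm ?_ (hup L)⟩
    set T := (fun z => (L z, c (L z) z)) '' C with hT
    have hiT : ∀ i, #(c i '' C) ≤ #T := by
      intro i
      refine (hJ i (z i) (hzC i)).trans ?_
      have hsub : Prod.mk (J i (z i)) '' (c (J i (z i)) '' levelCylinder c F (z i) k₁) ⊆ T := by
        rintro _ ⟨_, ⟨w, hw, rfl⟩, rfl⟩
        have hwC : w ∈ C := by
          have := hzC i
          rw [hC] at this ⊢
          exact ⟨hw.1, (H.mono hk₁k hw.2).trans this.2⟩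
        exact ⟨w, hwC, by simp only [hLi w i hw.2]⟩
      rw [← mk_image_eq (Prod.mk_right_injective (J i (z i)))]
      exact mk_le_mk_of_subset hsub
    refine (mk_levelNodes_le c C hiT).trans ?_
    rw [Cardinal.mul_eq_max' ?_]
    · exact max_le (hk₁.trans (hiT k₁)) le_rfl
    · exact le_mul_right (ne_of_gt (aleph0_pos.trans_le (hk₁.trans (hiT k₁))))

theorem cantorDecomposable_of_infinite_levels {X : Type*} {A : Type u} [MetricSpace X]
    {c : ℕ → X → A} (H : IsLevelCode c) {F : Set X} (hF : IsLevelClosed c F) (hne : F.Nonempty)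
    (hinf : ∀ z ∈ F, ∀ j, ∃ i, (c i '' levelCylinder c F z j).Infinite) :
    ∃ y ∈ F, ∃ n, CantorDecomposable (levelCylinder c F y n) := by
  let w : F × ℕ → Cardinal.{u} := fun p => #(levelNodes c (levelCylinder c F p.1 p.2))
  obtain ⟨y₀, hy₀⟩ := hne
  have : Nonempty (F × ℕ) := ⟨(⟨y₀, hy₀⟩, 0)⟩
  obtain ⟨⟨⟨y, hy⟩, n₀⟩, hmin⟩ : ∃ p, ∀ q, w p ≤ w q :=
    ⟨Function.argmin w, fun q => Function.argmin_le w q⟩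
  refine ⟨y, hy, n₀, ?_⟩
  set V := levelCylinder c F y n₀ with hVdef
  have hVF : V ⊆ F := fun z hz => hz.1
  have hwt : ∀ z ∈ V, ∀ j ≥ n₀, #(levelNodes c (levelCylinder c F z j)) = #(levelNodes c V) := by
    intro z hz j hj
    refine le_antisymm (mk_le_mk_of_subset (levelNodes_mono c fun x hx => ?_))
      (hmin (⟨z, hVF hz⟩, j))
    exact ⟨hx.1, (H.mono hj hx.2).trans hz.2⟩
  have hVcl : IsLevelClosed c V := fun x s hs hx =>
    ⟨hF x s (fun n => hVF (hs n)) hx, (hx n₀).trans (hs n₀).2⟩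
  let Λ := levelNodes c V
  have : Infinite Λ := by
    obtain ⟨i, hi⟩ := hinf y hy n₀
    rw [← Set.infinite_coe_iff, Cardinal.infinite_iff] at hi
    exact Cardinal.infinite_iff.2 (hi.trans (mk_image_le_mk_levelNodes c i V))
  let 𝒩 : ℕ → Set X → Prop := fun n C => ∃ z ∈ V, ∃ k, n ≤ k ∧ n₀ ≤ k ∧ C = levelCylinder c F z k
  have h0 : 𝒩 0 V := ⟨y, ⟨hy, rfl⟩, n₀, Nat.zero_le _, le_rfl, rfl⟩
  have hs : ∀ n C, 𝒩 n C → ∃ l : X → Λ, ∀ a, 𝒩 (n + 1) {x ∈ C | l x = a} := by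
    rintro n C ⟨z, hz, k, hnk, hk, hC⟩
    have hCV : C ⊆ V := by
      intro x hx
      rw [hC] at hx
      exact ⟨hx.1, (H.mono hk hx.2).trans hz.2⟩
    have hCw : #(levelNodes c C) = #Λ := by
      rw [hC]
      exact hwt z hz k hk
    obtain ⟨L, hL, hLc, hLcard⟩ := exists_partition_level H (hVF hz) hC
      (fun x hx j hj => (hwt x (hCV hx) j (hk.trans hj)).trans hCw.symm)
      (fun x hx j _ => hinf x (hVF (hCV hx)) j) (n + 1)
    rw [hCw] at hLcard
    obtain ⟨e⟩ := Cardinal.eq.1 hLcard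
    classical
    have hl₀ : Nonempty Λ := inferInstance
    let l : X → Λ := fun x => if hx : x ∈ C then e.symm ⟨_, x, hx, rfl⟩ else hl₀.some
    have hl : ∀ x ∈ C, ((e (l x)) : ℕ × A) = (L x, c (L x) x) := by
      intro x hx
      simp only [l, dif_pos hx, Equiv.apply_symm_apply]
    refine ⟨l, fun a => ?_⟩
    obtain ⟨x, hx, hxa⟩ := (e a).2
    refine ⟨x, hCV hx, L x, (hL x hx).1, hk.trans (hL x hx).2, ?_⟩
    ext v
    constructor
    · rintro ⟨hv, hva⟩
      have h1 := hl v hv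
      rw [hva, ← hxa] at h1
      simp only [Prod.mk.injEq] at h1
      refine ⟨hVF (hCV hv), ?_⟩
      rw [h1.2, ← h1.1]
    · rintro ⟨hv, hvx⟩
      have hvC : v ∈ C := by
        rw [hC] at hx ⊢
        refine ⟨hv, (H.mono ?_ hvx).trans hx.2⟩
        exact (hL x (hC ▸ hx)).2
      refine ⟨hvC, e.injective (Subtype.ext ?_)⟩
      rw [hl v hvC, ← hxa, hLc x hx v hvC hvx, hvx]
  obtain ⟨g, hg, hgV, hgc⟩ := exists_scheme_bijection H hVcl 𝒩 h0 hs
    (by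
      rintro n C ⟨z, hz, k, -, -, rfl⟩
      exact ⟨z, hVF hz, rfl⟩)
    (by
      rintro n C ⟨z, hz, k, -, -, rfl⟩
      exact ⟨k, fun x hx v hv h => ⟨hVF hv, h.trans hx.2⟩⟩)
    (by
      refine fun k => ⟨k, ?_⟩
      rintro C ⟨z, hz, j, hkj, -, rfl⟩ x hx v hv
      exact H.mono hkj (hx.2.trans hv.2.symm))
  rw [← hgV]
  exact cantorDecomposable_range_of_level H hg hgc

theorem almostDecomposable_univ {X : Type*} {A : Type u} [MetricSpace X]
    {c : ℕ → X → A} (H : IsLevelCode c) : AlmostDecomposable (univ : Set X) := by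
  let W : Set X := {x | ∃ n, AlmostDecomposable {y | c n y = c n x}}
  have hcyl : ∀ {k x y}, c k y = c k x → {z | c k z = c k y} = {z | c k z = c k x} := by
    intro k x y h
    simp only [h]
  have hW : ∀ {x y n}, c n y = c n x → AlmostDecomposable {z | c n z = c n x} → y ∈ W := by
    intro x y n h h'
    exact ⟨n, by rwa [hcyl h]⟩
  suffices hF : Wᶜ = ∅ by
    rw [compl_empty_iff] at hF
    refine AlmostDecomposable.of_cylinders H fun x _ => ?_
    obtain ⟨n, hn⟩ : x ∈ W := hF ▸ mem_univ x
    exact ⟨n, hn, subset_univ _⟩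
  by_contra hne
  replace hne := nonempty_iff_ne_empty.2 hne
  have hnot : ∀ x ∈ Wᶜ, ∀ n, ¬ AlmostDecomposable (levelCylinder c Wᶜ x n) := by
    intro x hx n h
    refine hx ⟨n, ?_⟩
    have hWn : AlmostDecomposable ({y | c n y = c n x} ∩ W) := by
      refine AlmostDecomposable.of_cylinders H ?_
      rintro y ⟨hyx, k, hk⟩
      refine ⟨k, hk, fun z hz => ⟨?_, hW hz hk⟩⟩
      rcases le_total n k with hnk | hnk
      · exact (H.mono hnk hz).trans hyx
      · exact absurd (hW (H.mono hnk hyx).symm hk) hx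
    have : {y | c n y = c n x} = ({y | c n y = c n x} ∩ W) ∪ levelCylinder c Wᶜ x n := by
      ext z
      simp only [levelCylinder, mem_union, mem_inter_iff, mem_ofPred_eq, mem_compl_iff]
      tauto
    rw [this]
    exact hWn.union (disjoint_left.2 fun z hz hz' => hz'.1 hz.2) h
  have hcl : IsLevelClosed c Wᶜ := by
    rintro y x hx hyx ⟨n, hn⟩
    exact hx n (hW (hyx n).symm hn)
  obtain ⟨y, hy, n, h⟩ := cantorDecomposable_of_infinite_levels H hcl hne (by
    intro z hz j
    by_contra! hfin
    refine hnot z hz j (IsCantorSet.cantorDecomposable ?_).almostDecomposable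
    refine isCantorSet_of_finite_levels H ?_ ⟨z, hz, rfl⟩ hfin ?_
    · exact fun x s hs hx => ⟨hcl x s (fun n => (hs n).1) hx, (hx j).trans (hs j).2⟩
    · intro x hx i
      by_contra! h
      refine hnot x hx.1 (max i j) (AlmostDecomposable.of_subsingleton ?_)
      have : ∀ v ∈ levelCylinder c Wᶜ x (max i j), v = x := fun v hv =>
        h v ⟨hv.1, (H.mono (le_max_right _ _) hv.2).trans hx.2⟩ (H.mono (le_max_left _ _) hv.2)
      exact fun v hv v' hv' => (this v hv).trans (this v' hv').symm)
  exact hnot y hy n h.almostDecomposable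

end Trees

section CantorSets

open Filter Topology

variable {X : Type*}

theorem IsCantorSet.isCompact [TopologicalSpace X] {K : Set X} (hK : IsCantorSet K) :
    IsCompact K := by
  obtain ⟨f, hf, -, rfl⟩ := hK
  exact isCompact_range hf

theorem IsCantorSet.not_countable [TopologicalSpace X] {K : Set X} (hK : IsCantorSet K) :
    ¬ K.Countable := by
  obtain ⟨f, -, hf, rfl⟩ := hK
  intro h
  have h1 : Countable CantorSpace := by
    have := h.to_subtype
    exact (rangeFactorization_injective.2 hf).countable
  have h2 : #CantorSpace ≤ ℵ₀ := mk_le_aleph0_iff.2 h1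
  simp only [mk_pi, mk_fintype, Fintype.card_bool, prod_const, mk_nat, lift_ofNat,
    Nat.cast_ofNat, lift_uzero] at h2
  exact absurd h2 (not_le.2 (cantor _))

theorem IsCantorSet.nonempty_homeomorph [TopologicalSpace X] [T2Space X] {K : Set X}
    (hK : IsCantorSet K) : Nonempty (K ≃ₜ CantorSpace) := by
  obtain ⟨f, hf, hi, rfl⟩ := hK
  exact ⟨(hf.isClosedEmbedding hi).isEmbedding.toHomeomorph.symm⟩

theorem isCantorSet_of_homeomorph [TopologicalSpace X] {K : Set X} (e : K ≃ₜ CantorSpace) :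
    IsCantorSet K :=
  ⟨fun b => e.symm b, continuous_subtype_val.comp e.symm.continuous,
    Subtype.val_injective.comp e.symm.injective, by
      rw [range_comp' Subtype.val e.symm, e.symm.surjective.range_eq, image_univ,
        Subtype.range_coe]⟩

theorem eventually_forall_lt_eq (b : CantorSpace) (n : ℕ) :
    ∀ᶠ d in 𝓝 b, ∀ i < n, d i = b i :=
  (PiNat.isOpen_cylinder (fun _ => Bool) b n).mem_nhds (PiNat.self_mem_cylinder b n)

theorem isCantorSet_image_cylinder [TopologicalSpace X] {f : CantorSpace → X} (hf : Continuous f)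
    (hi : Function.Injective f) (b : CantorSpace) (n : ℕ) :
    IsCantorSet (f '' {d | ∀ i < n, d i = b i}) := by
  refine ⟨fun t => f fun i => if i < n then b i else t (i - n), hf.comp ?_, ?_, ?_⟩
  · refine continuous_pi fun i => ?_
    split_ifs
    · exact continuous_const
    · exact continuous_apply _
  · intro t s h
    funext i
    have := congrFun (hi h) (n + i)
    simpa using this
  · ext x
    constructor
    · rintro ⟨t, rfl⟩
      exact ⟨_, fun i h => if_pos h, rfl⟩
    · rintro ⟨d, hd, rfl⟩
      refine ⟨fun i => d (n + i), congrArg f ?_⟩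
      funext i
      by_cases h : i < n
      · simp [h, hd i h]
      · simp [h, Nat.add_sub_of_le (not_lt.1 h)]

theorem cantorDecomposable_range_sdiff_cylinder [TopologicalSpace X] {f : CantorSpace → X}
    (hf : Continuous f) (hi : Function.Injective f) (b : CantorSpace) (n : ℕ) :
    CantorDecomposable (range f \ f '' {d | ∀ i < n, d i = b i}) := by
  induction n with
  | zero => simpa using CantorDecomposable.empty
  | succ n ih =>
    have e : range f \ f '' {d | ∀ i < n + 1, d i = b i} =
        (range f \ f '' {d | ∀ i < n, d i = b i}) ∪
          f '' {d | ∀ i < n + 1, d i = Function.update b n (!b n) i} := by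
      have h1 : ∀ d : CantorSpace, (∀ i < n + 1, d i = Function.update b n (!b n) i) ↔
          (∀ i < n, d i = b i) ∧ d n = !b n := by
        intro d
        rw [Nat.forall_lt_succ_right]
        refine and_congr (forall₂_congr fun i h => ?_) (by simp)
        rw [Function.update_of_ne h.ne]
      rw [← image_univ, ← image_sdiff hi, ← image_sdiff hi, ← image_union]
      congr 1
      ext d
      simp only [Set.mem_sdiff, mem_univ, true_and, mem_union, mem_ofPred_eq, h1,
        Nat.forall_lt_succ_right]
      generalize (∀ i < n, d i = b i) = p
      cases d n <;> cases b n <;> simp [em']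
    rw [e]
    refine ih.union ?_ (isCantorSet_image_cylinder hf hi _ _).cantorDecomposable
    rw [disjoint_left]
    rintro _ ⟨-, h⟩ ⟨d, hd, rfl⟩
    refine h ⟨d, fun i h => ?_, rfl⟩
    rw [hd i (by omega), Function.update_of_ne h.ne]

/-- A Cantor set contains arbitrarily small Cantor subsets near each of its points, with a
decomposable complement. -/
theorem IsCantorSet.exists_subset_of_mem_nhds [TopologicalSpace X] {K : Set X}
    (hK : IsCantorSet K) {y : X} (hy : y ∈ K) {U : Set X} (hU : U ∈ 𝓝 y) :
    ∃ L, IsCantorSet L ∧ L ⊆ K ∧ L ⊆ U ∧ CantorDecomposable (K \ L) := by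
  obtain ⟨f, hf, hi, rfl⟩ := hK
  obtain ⟨b, rfl⟩ := hy
  obtain ⟨_, ⟨d, n, rfl⟩, hb, hV⟩ :=
    (PiNat.isTopologicalBasis_cylinders fun _ => Bool).mem_nhds_iff.1 (hf.continuousAt hU)
  refine ⟨_, isCantorSet_image_cylinder hf hi d n, image_subset_range _ _, ?_,
    cantorDecomposable_range_sdiff_cylinder hf hi d n⟩
  exact image_subset_iff.2 hV

/-- A point together with a sequence of disjoint Cantor sets shrinking to it is a Cantor set. -/
theorem isCantorSet_insert_iUnion [MetricSpace X] {x : X} {K : ℕ → Set X}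
    (hK : ∀ n, IsCantorSet (K n)) (hd : Pairwise (Function.onFun Disjoint K))
    (hx : ∀ n, x ∉ K n) (hlim : ∀ n, ∀ y ∈ K n, dist y x < 1 / ((n : ℝ) + 1)) :
    IsCantorSet (insert x (⋃ n, K n)) := by
  classical
  choose f hf hi hr using hK
  let F : CantorSpace → X := fun b =>
    if h : ∃ n, b n = true then f (Nat.find h) (fun i => b (Nat.find h + 1 + i)) else x
  have hF0 : ∀ b, (∀ i, b i = false) → F b = x := by
    intro b hb
    have : ¬ ∃ n, b n = true := by simp [hb]
    exact dif_neg this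
  have hF1 : ∀ b n, (∀ i < n, b i = false) → b n = true →
      F b = f n fun i => b (n + 1 + i) := by
    intro b n hn hb
    have h : ∃ n, b n = true := ⟨n, hb⟩
    have e : Nat.find h = n := (Nat.find_eq_iff h).2 ⟨hb, fun i hin => by simp [hn i hin]⟩
    simp only [F, dif_pos h, e]
  have hcases : ∀ b : CantorSpace, (∀ i, b i = false) ∨
      ∃ n, (∀ i < n, b i = false) ∧ b n = true := by
    intro b
    by_cases h : ∃ n, b n = true
    · exact Or.inr ⟨Nat.find h, fun i hi => by simpa using Nat.find_min h hi, Nat.find_spec h⟩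
    · left
      simpa using h
  have hmem : ∀ n t, f n t ∈ K n := fun n t => hr n ▸ mem_range_self t
  refine ⟨F, continuous_iff_continuousAt.2 fun b => ?_, ?_, ?_⟩
  · rcases hcases b with hb | ⟨n, hn, hb⟩
    · rw [ContinuousAt, hF0 b hb, Metric.tendsto_nhds]
      intro ε hε
      obtain ⟨n, hn⟩ := exists_nat_one_div_lt hε
      filter_upwards [eventually_forall_lt_eq b n] with d hdb
      rcases hcases d with h | ⟨k, hk, h⟩
      · rw [hF0 d h, dist_self]
        exact hε
      · rw [hF1 d k hk h]
        have hnk : n ≤ k := by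
          by_contra! hkn
          rw [hdb k hkn, hb k] at h
          cases h
        exact (hlim k _ (hmem k _)).trans ((one_div_succ_le_of_le hnk).trans_lt hn)
    · have h1 : Continuous fun d : CantorSpace => f n fun i => d (n + 1 + i) :=
        (hf n).comp (continuous_pi fun i => continuous_apply _)
      refine h1.continuousAt.congr ?_
      filter_upwards [eventually_forall_lt_eq b (n + 1)] with d hdb
      exact (hF1 d n (fun i hi => (hdb i (by omega)).trans (hn i hi))
        ((hdb n (by omega)).trans hb)).symm
  · intro b d h
    rcases hcases b with hb | ⟨n, hn, hb⟩ <;> rcases hcases d with hd' | ⟨k, hk, hd'⟩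
    · exact funext fun i => (hb i).trans (hd' i).symm
    · rw [hF0 b hb, hF1 d k hk hd'] at h
      exact (hx k (h ▸ hmem k _)).elim
    · rw [hF1 b n hn hb, hF0 d hd'] at h
      exact (hx n (h ▸ hmem n _)).elim
    · rw [hF1 b n hn hb, hF1 d k hk hd'] at h
      obtain rfl : n = k := by
        by_contra hne
        exact disjoint_left.1 (hd hne) (hmem n _) (h ▸ hmem k _)
      have ht := hi n h
      funext i
      rcases lt_trichotomy i n with hin | rfl | hin
      · rw [hn i hin, hk i hin]
      · rw [hb, hd']
      · have := congrFun ht (i - (n + 1))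
        simpa [Nat.add_sub_of_le (Nat.succ_le_of_lt hin)] using this
  · ext y
    constructor
    · rintro ⟨b, rfl⟩
      rcases hcases b with hb | ⟨n, hn, hb⟩
      · rw [hF0 b hb]
        exact mem_insert _ _
      · rw [hF1 b n hn hb]
        exact mem_insert_of_mem _ (mem_iUnion.2 ⟨n, hmem n _⟩)
    · rintro (rfl | hy)
      · exact ⟨fun _ => false, hF0 _ fun _ => rfl⟩
      · obtain ⟨n, hn⟩ := mem_iUnion.1 hy
        obtain ⟨t, rfl⟩ := (hr n).symm ▸ hn
        refine ⟨fun i => if i < n then false else if i = n then true else t (i - (n + 1)), ?_⟩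
        rw [hF1 _ n (fun i hi => if_pos hi) (by simp)]
        congr 1
        funext i
        rw [if_neg (by omega), if_neg (by omega), Nat.add_sub_cancel_left]

end CantorSets

section Absorption

open Filter Topology

theorem exists_injective_nat_of_infinite {β : Type*} {A : ℕ → Set β} (hA : ∀ n, (A n).Infinite) :
    ∃ f : ℕ → β, Function.Injective f ∧ ∀ n, f n ∈ A n := by
  classical
  choose pick hp hp' using fun n => (hA n).exists_notMem_finset
  let L : ℕ → Finset β := fun n => n.rec ∅ fun k F => insert (pick k F) F
  have hL : Monotone L := monotone_nat_of_le_succ fun n => Finset.subset_insert _ _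
  have hmem : ∀ n, pick n (L n) ∈ L (n + 1) := fun n => Finset.mem_insert_self _ _
  refine ⟨fun n => pick n (L n), ?_, fun n => hp _ _⟩
  refine Function.Injective.of_lt_imp_ne fun m n hmn h => hp' n (L n) ?_
  rw [← h]
  exact hL (Nat.succ_le_of_lt hmn) (hmem m)

theorem exists_injective_of_infinite {P β : Type*} [Countable P] {A : P → Set β}
    (hA : ∀ p, (A p).Infinite) : ∃ f : P → β, Function.Injective f ∧ ∀ p, f p ∈ A p := by
  cases isEmpty_or_nonempty P
  · exact ⟨fun p => isEmptyElim p, fun p => isEmptyElim p, fun p => isEmptyElim p⟩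
  · obtain ⟨e, he⟩ := exists_surjective_nat P
    obtain ⟨f, hf, hfA⟩ := exists_injective_nat_of_infinite fun n => hA (e n)
    refine ⟨f ∘ Function.surjInv he, hf.comp (Function.injective_surjInv he), fun p => ?_⟩
    have := hfA (Function.surjInv he p)
    rwa [Function.surjInv_eq he] at this

theorem countable_setOf_reflTransGen {α : Type*} {r : α → α → Prop}
    (hr : ∀ x, {y | r x y}.Countable) (x : α) : {y | Relation.ReflTransGen r x y}.Countable := by
  let S : ℕ → Set α := fun n => n.rec {x} fun _ T => ⋃ y ∈ T, {z | r y z}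
  have hS : ∀ n, (S n).Countable := by
    intro n
    induction n with
    | zero => exact countable_singleton x
    | succ n ih => exact ih.biUnion fun y _ => hr y
  refine (countable_iUnion hS).mono fun y hy => ?_
  induction hy with
  | refl => exact mem_iUnion.2 ⟨0, rfl⟩
  | @tail y z _ hyz ih =>
    obtain ⟨n, hn⟩ := mem_iUnion.1 ih
    exact mem_iUnion.2 ⟨n + 1, mem_iUnion₂.2 ⟨y, hn, hyz⟩⟩

/-- An injective choice of values for a family of sequences, each value being taken by only
countably many of the sequences and only finitely often by each of them. -/
theorem exists_injective_choice {α β : Type*} {g : α → ℕ → β}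
    (hfin : ∀ x b, {n | g x n = b}.Finite) (hcount : ∀ b, {x | ∃ n, g x n = b}.Countable) :
    ∃ f : α × ℕ → β, Function.Injective f ∧ ∀ p, ∃ k, p.2 ≤ k ∧ f p = g p.1 k := by
  let r : α → α → Prop := fun x y => ∃ n k, g y k = g x n
  have hr : ∀ x, {y | r x y}.Countable := by
    intro x
    have : {y | r x y} = ⋃ n, {y | ∃ k, g y k = g x n} := by
      ext y
      simp [r]
    rw [this]
    exact countable_iUnion fun n => hcount _
  have : Std.Symm r := ⟨fun x y ⟨n, k, h⟩ => ⟨k, n, h.symm⟩⟩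
  let s : Setoid α := ⟨Relation.ReflTransGen r, fun _ => .refl,
    fun h => symm_of (Relation.ReflTransGen r) h, fun h h' => h.trans h'⟩
  have hc : ∀ q : Quotient s, Countable {x : α // (⟦x⟧ : Quotient s) = q} := by
    intro q
    obtain ⟨x, rfl⟩ := Quotient.exists_rep q
    refine ((countable_setOf_reflTransGen hr x).mono fun y hy => ?_).to_subtype
    exact s.symm (Quotient.exact hy)
  have hinf : ∀ x n, {b | ∃ k, n ≤ k ∧ b = g x k}.Infinite := by
    intro x n h
    refine (Set.Ici_infinite n) ((h.preimage' fun b _ => hfin x b).subset fun k hk => ?_)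
    exact ⟨k, hk, rfl⟩
  choose f hf hfg using fun q : Quotient s =>
    exists_injective_of_infinite (P := {x : α // (⟦x⟧ : Quotient s) = q} × ℕ)
      fun p => hinf p.1 p.2
  have hF : ∀ (q : Quotient s) (p : α × ℕ) (h : ⟦p.1⟧ = q),
      f ⟦p.1⟧ (⟨p.1, rfl⟩, p.2) = f q (⟨p.1, h⟩, p.2) := by
    rintro _ p rfl
    rfl
  refine ⟨fun p => f ⟦p.1⟧ (⟨p.1, rfl⟩, p.2), fun p p' h => ?_, fun p => hfg _ (_, _)⟩
  have hpp : (⟦p'.1⟧ : Quotient s) = ⟦p.1⟧ := by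
    obtain ⟨n, -, hn⟩ := hfg ⟦p.1⟧ (⟨p.1, rfl⟩, p.2)
    obtain ⟨k, -, hk⟩ := hfg ⟦p'.1⟧ (⟨p'.1, rfl⟩, p'.2)
    exact Quotient.sound (Relation.ReflTransGen.single ⟨k, n, hn.symm.trans (h.trans hk)⟩)
  simp only [hF _ p' hpp] at h
  have := hf _ h
  simp only [Prod.mk.injEq, Subtype.mk.injEq] at this
  exact Prod.ext this.1 this.2

theorem finite_of_separated_of_isCompact {X P : Type*} [MetricSpace X] {K : Set X}
    (hK : IsCompact K) {ε : ℝ} (hε : 0 < ε) {S : Set P} {y : P → X} (hy : ∀ p ∈ S, y p ∈ K)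
    (hsep : ∀ p ∈ S, ∀ q ∈ S, dist (y p) (y q) < ε → p = q) : S.Finite := by
  obtain ⟨t, ht, hKt⟩ := Metric.totallyBounded_iff.1 hK.totallyBounded (ε / 2) (half_pos hε)
  have h : ∀ p : P, ∃ c, p ∈ S → c ∈ t ∧ dist (y p) c < ε / 2 := by
    intro p
    by_cases hp : p ∈ S
    · obtain ⟨c, hc, hpc⟩ := mem_iUnion₂.1 (hKt (hy p hp))
      exact ⟨c, fun _ => ⟨hc, hpc⟩⟩
    · exact ⟨y p, fun h => (hp h).elim⟩
  choose c hc using h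
  refine Set.Finite.of_injOn (f := c) (fun p hp => (hc p hp).1) (fun p hp q hq hpq => ?_) ht
  refine hsep p hp q hq ?_
  have h1 := (hc p hp).2
  have h2 := (hc q hq).2
  rw [← hpq] at h2
  linarith [dist_triangle_right (y p) (y q) (c p)]

theorem SigmaDiscreteOn.countable_inter_of_isCompact {X : Type*} [MetricSpace X] {N K : Set X}
    (hN : SigmaDiscreteOn N fun x => x) (hK : IsCompact K) : (N ∩ K).Countable := by
  obtain ⟨m, hm⟩ := hN
  have : N ∩ K = ⋃ j, {x ∈ N ∩ K | m x = j} := by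
    ext x
    simp
  rw [this]
  refine countable_iUnion fun j => Set.Finite.countable ?_
  refine finite_of_separated_of_isCompact hK (Nat.one_div_pos_of_nat (n := j)) (y := fun x => x)
    (fun x hx => hx.1.2) ?_
  rintro x ⟨⟨hx, -⟩, rfl⟩ y ⟨⟨hy, -⟩, hxy⟩ h
  exact hm x hx y hy hxy.symm h

/-- In a space covered by Cantor sets, a σ-discrete set can be absorbed in a decomposition of its
complement into Cantor sets. -/
theorem AlmostDecomposable.cantorDecomposable_univ {X : Type*} [MetricSpace X]
    (hX : ∀ x : X, ∃ C, IsCantorSet C ∧ x ∈ C) (h : AlmostDecomposable (univ : Set X)) :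
    CantorDecomposable (univ : Set X) := by
  classical
  obtain ⟨N, -, hN, Q, hQ, hQd, hQN⟩ := h
  have hnotN : ∀ K ∈ Q, ∀ x ∈ K, x ∉ N := by
    intro K hK x hx
    have : x ∈ Set.univ \ N := hQN ▸ mem_sUnion_of_mem hx hK
    exact this.2
  have hnear : ∀ x : X, ∀ ε > 0, ∃ K : Q, ∃ y ∈ K.1, dist y x < ε := by
    intro x ε hε
    obtain ⟨C, hC, hxC⟩ := hX x
    obtain ⟨L, hL, -, hLU, -⟩ := hC.exists_subset_of_mem_nhds hxC (Metric.ball_mem_nhds x hε)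
    have : ¬ L ⊆ N := fun hLN => hL.not_countable
      ((hN.countable_inter_of_isCompact hL.isCompact).mono (subset_inter hLN subset_rfl))
    obtain ⟨y, hyL, hyN⟩ := not_subset.1 this
    obtain ⟨K, hK, hyK⟩ : y ∈ ⋃₀ Q := by
      rw [hQN]
      exact ⟨mem_univ y, hyN⟩
    exact ⟨⟨K, hK⟩, y, hyK, hLU hyL⟩
  obtain ⟨m, hm⟩ := hN
  choose g y hyK hy using fun (x : N) (n : ℕ) => hnear x
    (min (1 / ((n : ℝ) + 1)) (1 / ((m x : ℝ) + 1) / 3))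
    (lt_min Nat.one_div_pos_of_nat (div_pos Nat.one_div_pos_of_nat three_pos))
  have hy1 : ∀ x n, dist (y x n) x < 1 / ((n : ℝ) + 1) := fun x n =>
    (hy x n).trans_le (min_le_left _ _)
  have hy2 : ∀ x n, dist (y x n) x < 1 / ((m x : ℝ) + 1) / 3 := fun x n =>
    (hy x n).trans_le (min_le_right _ _)
  have hfin : ∀ x K, {n | g x n = K}.Finite := by
    intro x K
    have hcl : IsClosed K.1 := (hQ K K.2).isCompact.isClosed
    have hx : (K.1)ᶜ ∈ 𝓝 x.1 := hcl.isOpen_compl.mem_nhds fun h => hnotN K K.2 x h x.2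
    obtain ⟨ε, hε, hball⟩ := Metric.mem_nhds_iff.1 hx
    obtain ⟨k, hk⟩ := exists_nat_one_div_lt hε
    refine (Set.finite_lt_nat k).subset ?_
    rintro n rfl
    by_contra hkn
    replace hkn : k ≤ n := not_lt.1 hkn
    exact hball ((hy1 x n).trans_le ((one_div_succ_le_of_le hkn).trans hk.le)) (hyK x n)
  have hcount : ∀ K, {x | ∃ n, g x n = K}.Countable := by
    intro K
    have : {x | ∃ n, g x n = K} = ⋃ j, {x : N | m x = j ∧ ∃ n, g x n = K} := by
      ext x
      simp
    rw [this]
    refine countable_iUnion fun j => Set.Finite.countable ?_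
    have hz : ∀ x : N, ∃ z, (∃ n, g x n = K) → z ∈ K.1 ∧ dist z x < 1 / ((m x : ℝ) + 1) / 3 := by
      intro x
      by_cases h : ∃ n, g x n = K
      · obtain ⟨n, rfl⟩ := h
        exact ⟨y x n, fun _ => ⟨hyK x n, hy2 x n⟩⟩
      · exact ⟨x, fun h' => (h h').elim⟩
    choose z hz using hz
    refine finite_of_separated_of_isCompact (hQ K K.2).isCompact
      (div_pos (Nat.one_div_pos_of_nat (n := j)) three_pos) (y := z)
      (fun x hx => (hz x hx.2).1) ?_
    rintro x ⟨rfl, hx⟩ x' ⟨hxx', hx'⟩ h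
    have h1 := (hz x hx).2
    have h2 := (hz x' hx').2
    rw [hxx'] at h2
    refine Subtype.ext (hm x x.2 x' x'.2 hxx'.symm ?_)
    have h3 := dist_triangle4_right x.1 x'.1 (z x) (z x')
    rw [dist_comm x.1 (z x), dist_comm x'.1 (z x')] at h3
    linarith
  obtain ⟨f, hf, hfg⟩ := exists_injective_choice hfin hcount
  have hL : ∀ p : N × ℕ, ∃ L, IsCantorSet L ∧ L ⊆ (f p).1 ∧
      (∀ y ∈ L, dist y p.1 < 1 / ((p.2 : ℝ) + 1)) ∧ CantorDecomposable ((f p).1 \ L) := by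
    intro p
    obtain ⟨k, hk, hp⟩ := hfg p
    have hyk : y p.1 k ∈ (f p).1 := hp ▸ hyK p.1 k
    refine (hQ _ (f p).2).exists_subset_of_mem_nhds hyk (U := Metric.ball p.1.1 _)
      (Metric.isOpen_ball.mem_nhds ?_)
    exact (hy1 p.1 k).trans_le (one_div_succ_le_of_le hk)
  choose L hLC hLf hLx hLd using hL
  have hQdisj : ∀ K K' : Q, K ≠ K' → Disjoint K.1 K'.1 := fun K K' h =>
    hQd K.2 K'.2 (Subtype.coe_ne_coe.2 h)
  have hLdisj : ∀ p p', p ≠ p' → Disjoint (L p) (L p') := fun p p' h =>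
    (hQdisj _ _ (hf.ne h)).mono (hLf p) (hLf p')
  have hLN : ∀ p, ∀ y ∈ L p, y ∉ N := fun p y hy => hnotN _ (f p).2 y (hLf p hy)
  have hA : CantorDecomposable (⋃ x : N, insert x.1 (⋃ n, L (x, n))) := by
    refine CantorDecomposable.iUnion ?_ fun x => IsCantorSet.cantorDecomposable ?_
    · intro x x' hne
      rw [Function.onFun, disjoint_left]
      rintro y (rfl | hy) (hyx | hy')
      · exact hne (Subtype.ext hyx)
      · obtain ⟨n, hn⟩ := mem_iUnion.1 hy'
        exact hLN _ _ hn x.2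
      · subst hyx
        obtain ⟨n, hn⟩ := mem_iUnion.1 hy
        exact hLN _ _ hn x'.2
      · obtain ⟨n, hn⟩ := mem_iUnion.1 hy
        obtain ⟨k, hk⟩ := mem_iUnion.1 hy'
        exact disjoint_left.1 (hLdisj (x, n) (x', k) (by simp [hne])) hn hk
    · exact isCantorSet_insert_iUnion (fun n => hLC _)
        (fun n k hnk => hLdisj _ _ (by simpa using hnk)) (fun n hn => hLN _ _ hn x.2)
        (fun n => hLx (x, n))
  have hB : CantorDecomposable (⋃ K : Q, K.1 \ ⋃ p, L p) := by
    refine CantorDecomposable.iUnion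
      (fun K K' h => (hQdisj K K' h).mono sdiff_subset sdiff_subset) fun K => ?_
    by_cases hp : ∃ p, f p = K
    · obtain ⟨p, rfl⟩ := hp
      convert hLd p using 1
      refine Subset.antisymm (sdiff_subset_sdiff_right (subset_iUnion L p)) ?_
      rintro y ⟨hyf, hyL⟩
      refine ⟨hyf, fun h => ?_⟩
      obtain ⟨p', hp'⟩ := mem_iUnion.1 h
      by_cases hpp : p' = p
      · exact hyL (hpp ▸ hp')
      · exact disjoint_left.1 (hQdisj _ _ (hf.ne hpp)) (hLf p' hp') hyf
    · convert (hQ K K.2).cantorDecomposable using 1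
      refine Subset.antisymm sdiff_subset fun y hy => ⟨hy, fun h => ?_⟩
      obtain ⟨p, hp'⟩ := mem_iUnion.1 h
      exact disjoint_left.1 (hQdisj _ _ fun e => hp ⟨p, e⟩) (hLf p hp') hy
  convert hA.union ?_ hB using 1
  · refine (eq_univ_of_forall fun y => ?_).symm
    by_cases hyN : y ∈ N
    · exact Or.inl (mem_iUnion.2 ⟨⟨y, hyN⟩, mem_insert _ _⟩)
    · obtain ⟨K, hK, hyK⟩ : y ∈ ⋃₀ Q := hQN.symm ▸ ⟨mem_univ y, hyN⟩
      by_cases hyL : ∃ p, y ∈ L p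
      · obtain ⟨p, hp⟩ := hyL
        exact Or.inl (mem_iUnion.2 ⟨p.1, mem_insert_of_mem _ (mem_iUnion.2 ⟨p.2, hp⟩)⟩)
      · exact Or.inr (mem_iUnion.2 ⟨⟨K, hK⟩, hyK, by simpa using hyL⟩)
  · rw [disjoint_left]
    intro y hy hy'
    obtain ⟨x, rfl | hx⟩ := mem_iUnion.1 hy <;> obtain ⟨K, hK, hKL⟩ := mem_iUnion.1 hy'
    · exact hnotN K K.2 _ hK x.2
    · obtain ⟨n, hn⟩ := mem_iUnion.1 hx
      exact hKL (mem_iUnion.2 ⟨_, hn⟩)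

end Absorption

section LevelCode

open Filter Topology

theorem exists_isLevelCode {X Z : Type*} [MetricSpace X] [MetricSpace Z] {φ : X → Z}
    (hφ : Isometry φ) (h : IsCoded (range φ)) :
    ∃ c : ℕ → X → List (CodeLabel Z), IsLevelCode c := by
  obtain ⟨h, hh⟩ := h
  let c : ℕ → X → List (CodeLabel Z) := fun n x => (List.range n).map (h (φ x))
  have hc : ∀ {n x y}, c n x = c n y ↔ ∀ i < n, h (φ x) i = h (φ y) i := by
    intro n x y
    simp [c, List.map_inj_left]
  refine ⟨c, fun hmn _ _ e => hc.2 fun i hi => hc.1 e i (hi.trans_le hmn), fun n => ?_,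
    fun x a ha => ?_, fun {x y} e => hφ.injective (hh.injOn (mem_range_self x) (mem_range_self y)
      (funext fun i => hc.1 (e (i + 1)) i i.lt_succ_self))⟩
  · have hk : ∀ k, SigmaDiscreteOn univ fun x => h (φ x) k := by
      intro k
      obtain ⟨m, hm⟩ := hh.sigmaDiscrete k
      exact ⟨fun x => m (φ x), fun x _ y _ e hxy => hm _ (mem_range_self x) _ (mem_range_self y) e
        (by rwa [hφ.dist_eq])⟩
    induction n with
    | zero => exact ⟨fun _ => 0, fun _ _ _ _ _ _ => rfl⟩
    | succ n ih =>
      have := (ih.prodMk (hk n)).comp fun p => p.1 ++ [p.2]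
      simpa only [c, List.range_succ, List.map_append, List.map_cons, List.map_nil] using this
  · choose k hk using fun n => (ha n).exists
    have ha' : ∀ i, ∀ᶠ j in atTop, h (φ (x j)) i = h (φ (x (k (i + 1)))) i := fun i =>
      (ha (i + 1)).mono fun j hj => hc.1 (hj.trans (hk (i + 1)).symm) i i.lt_succ_self
    obtain ⟨_, ⟨y, rfl⟩, hya, hy⟩ := hh.lim (fun j => φ (x j)) _ (fun j => mem_range_self _) ha'
    refine ⟨y, fun n => ?_, hφ.isEmbedding.tendsto_nhds_iff.2 hy⟩
    have hn := (eventually_all_finite (Set.finite_lt_nat n)).2 fun i _ => ha' i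
    obtain ⟨j, hj, hjn⟩ := (hn.and (ha n)).exists
    rw [← hjn]
    exact hc.2 fun i hi => (congrFun hya i).trans (hj i hi).symm

end LevelCode

theorem cantorDecomposable_univ_of_isAbsoluteBorel {X : Type u} [TopologicalSpace X]
    (hB : IsAbsoluteBorel X) (hX : ∀ x : X, ∃ C, IsCantorSet C ∧ x ∈ C) :
    CantorDecomposable (univ : Set X) := by
  obtain ⟨Z, _, _, B, hB, ⟨e⟩⟩ := hB
  have he : Topology.IsEmbedding fun x => (e x : Z) :=
    Topology.IsEmbedding.subtypeVal.comp e.isEmbedding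
  let _ : MeasurableSpace Z := borel Z
  have : BorelSpace Z := ⟨rfl⟩
  let _ : MetricSpace X := he.comapMetricSpace
  have hi : Isometry fun x => (e x : Z) := Isometry.of_dist_eq fun _ _ => rfl
  have hr : range (fun x => (e x : Z)) = B := by
    rw [range_comp' Subtype.val e, e.surjective.range_eq, image_univ, Subtype.range_coe]
  obtain ⟨c, hc⟩ := exists_isLevelCode hi (hr.symm ▸ isCoded_of_measurableSet hB)
  exact (almostDecomposable_univ hc).cantorDecomposable_univ hX

theorem stmt_14 {X : Type u} [TopologicalSpace X] [MetrizableSpace X]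
    (hB : IsAbsoluteBorel X) :
    Partitionable X CantorSpace ↔ Coverable X CantorSpace := by
  constructor
  · rintro ⟨P, hP, -, h⟩
    exact ⟨P, hP, h⟩
  · rintro ⟨C, hC, h⟩
    obtain ⟨Q, hQ, hd, hQu⟩ := cantorDecomposable_univ_of_isAbsoluteBorel hB fun x => by
      obtain ⟨K, hK, hx⟩ : x ∈ ⋃₀ C := h ▸ mem_univ x
      obtain ⟨e⟩ := hC K hK
      exact ⟨K, isCantorSet_of_homeomorph e, hx⟩
    exact ⟨Q, fun K hK => (hQ K hK).nonempty_homeomorph, hd, hQu⟩
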